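/- arXiv:1103.1110 — 12 statements merged into one kernel-verified Lean document; each statement's English description precedes it below -/
import Mathlib

section
/- Let A be a real n×n skew-symmetric matrix, let h = (1/n)·A·1 (the vector of row sums of A divided by n), and let H be the matrix with H_{ij} = h_i − h_j. Then tr((A − H)ᵀ W) = 0 for every strongly transitive matrix W; consequently H is the orthogonal projection of A onto the subspace of strongly transitive matrices, and H is the unique minimizer of the Frobenius norm ‖A − W‖ over strongly transitive W. -/
open Matrix

/-- A real square matrix is strongly transitive if `W i k = W i j + W j k` for all indices. -/
def StronglyTransitive {n : ℕ} (W : Matrix (Fin n) (Fin n) ℝ) : Prop :=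
  ∀ i j k, W i k = W i j + W j k

/-- The HodgeRank vector of a matrix: row sums divided by n. -/
noncomputable def hodgeVec {n : ℕ} (A : Matrix (Fin n) (Fin n) ℝ) : Fin n → ℝ :=
  fun i => (∑ j, A i j) / n

lemma StronglyTransitive.sub {n : ℕ} {V W : Matrix (Fin n) (Fin n) ℝ}
    (hV : StronglyTransitive V) (hW : StronglyTransitive W) : StronglyTransitive (V - W) := by
  intro i j k
  simp only [Matrix.sub_apply]
  linarith [hV i j k, hW i j k]

/-- A matrix with vanishing row and column sums is orthogonal to the strongly transitive ones. -/
lemma StronglyTransitive.sum_mul_eq_zero {n : ℕ} {R W : Matrix (Fin n) (Fin n) ℝ}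
    (hrow : ∀ i, ∑ j, R i j = 0) (hcol : ∀ j, ∑ i, R i j = 0) (hW : StronglyTransitive W) :
    ∑ i, ∑ j, R i j * W i j = 0 := by
  rcases n with _ | n
  · simp
  · have hRW : ∀ i j, R i j * W i j = R i j * W i 0 - R i j * W j 0 := fun i j => by
      rw [hW i j 0]; ring
    simp_rw [hRW, Finset.sum_sub_distrib]
    rw [Finset.sum_comm (f := fun i j => R i j * W j 0)]
    simp_rw [← Finset.sum_mul, hrow, hcol]
    simp

lemma sum_hodgeVec_eq_zero {n : ℕ} {A : Matrix (Fin n) (Fin n) ℝ} (hA : Aᵀ = -A) :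
    ∑ i, hodgeVec A i = 0 := by
  have hskew : ∀ i j, A j i = -A i j := fun i j => congrFun (congrFun hA i) j
  have hsum : ∑ i, ∑ j, A i j = -∑ i, ∑ j, A i j := by
    refine Finset.sum_comm.trans ?_
    simp_rw [← Finset.sum_neg_distrib]
    exact Finset.sum_congr rfl fun i _ => Finset.sum_congr rfl fun j _ => hskew i j
  simp only [hodgeVec]
  rw [← Finset.sum_div, show ∑ i, ∑ j, A i j = 0 by linarith, zero_div]

lemma sum_sub_hodgeVec_eq_zero {n : ℕ} {A : Matrix (Fin n) (Fin n) ℝ} (hA : Aᵀ = -A)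
    (i : Fin n) : ∑ j, (A i j - (hodgeVec A i - hodgeVec A j)) = 0 := by
  have hn : (n : ℝ) ≠ 0 := Nat.cast_ne_zero.mpr i.pos.ne'
  simp only [Finset.sum_sub_distrib, sum_hodgeVec_eq_zero hA, Finset.sum_const,
    Finset.card_univ, Fintype.card_fin, nsmul_eq_mul, sub_zero]
  rw [hodgeVec, mul_div_cancel₀ _ hn, sub_self]

/-- for skew-symmetric A, with h the HodgeRank vector and
H_{ij} = h_i − h_j, the residual A − H is trace-orthogonal to every strongly
transitive matrix; consequently H is strongly transitive and is the unique
minimizer of the Frobenius distance from A to the strongly transitive matrices. -/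
theorem hodge_is_orthogonal_projection (n : ℕ) (A : Matrix (Fin n) (Fin n) ℝ)
    (hA : Aᵀ = -A) (H : Matrix (Fin n) (Fin n) ℝ)
    (hH : ∀ i j, H i j = hodgeVec A i - hodgeVec A j) :
    StronglyTransitive H ∧
    (∀ W : Matrix (Fin n) (Fin n) ℝ, StronglyTransitive W →
      Matrix.trace ((A - H)ᵀ * W) = 0) ∧
    (∀ W : Matrix (Fin n) (Fin n) ℝ, StronglyTransitive W →
      (∑ i, ∑ j, (A i j - H i j) ^ 2) ≤ ∑ i, ∑ j, (A i j - W i j) ^ 2) ∧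
    (∀ W : Matrix (Fin n) (Fin n) ℝ, StronglyTransitive W → W ≠ H →
      (∑ i, ∑ j, (A i j - H i j) ^ 2) < ∑ i, ∑ j, (A i j - W i j) ^ 2) := by
  have hskew : ∀ i j, A j i = -A i j := fun i j => congrFun (congrFun hA i) j
  have hrow : ∀ i, ∑ j, (A - H) i j = 0 := fun i => by
    simpa only [Matrix.sub_apply, hH] using sum_sub_hodgeVec_eq_zero hA i
  have hcol : ∀ j, ∑ i, (A - H) i j = 0 := fun j => by
    rw [← neg_eq_zero, ← Finset.sum_neg_distrib, ← hrow j]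
    refine Finset.sum_congr rfl fun i _ => ?_
    rw [Matrix.sub_apply, Matrix.sub_apply, hskew j i, hH, hH]
    ring
  have hHst : StronglyTransitive H := fun i j k => by
    rw [hH, hH, hH]; ring
  have pythagoras : ∀ W : Matrix (Fin n) (Fin n) ℝ, StronglyTransitive W →
      ∑ i, ∑ j, (A i j - W i j) ^ 2 =
        ∑ i, ∑ j, (A i j - H i j) ^ 2 + ∑ i, ∑ j, (H i j - W i j) ^ 2 := by
    intro W hW
    have horth := (hHst.sub hW).sum_mul_eq_zero hrow hcol
    have hexpand : ∀ i j, (A i j - W i j) ^ 2 =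
        (A i j - H i j) ^ 2 + (H i j - W i j) ^ 2 + 2 * ((A - H) i j * (H - W) i j) :=
      fun i j => by simp only [Matrix.sub_apply]; ring
    simp_rw [hexpand, Finset.sum_add_distrib, ← Finset.mul_sum]
    rw [horth, mul_zero, add_zero]
  refine ⟨hHst, fun W hW => ?_, fun W hW => ?_, fun W hW hne => ?_⟩
  · rw [← hW.sum_mul_eq_zero hrow hcol, Finset.sum_comm]
    rfl
  · rw [pythagoras W hW]
    exact le_add_of_nonneg_right (by positivity)
  · rw [pythagoras W hW]
    refine lt_add_of_pos_right _ ?_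
    obtain ⟨i, j, hij⟩ : ∃ i j, W i j ≠ H i j := by
      by_contra! h
      exact hne (Matrix.ext h)
    exact Finset.sum_pos' (fun _ _ => by positivity) ⟨i, Finset.mem_univ i,
      Finset.sum_pos' (fun _ _ => by positivity) ⟨j, Finset.mem_univ j,
        sq_pos_of_ne_zero (sub_ne_zero.mpr hij.symm)⟩⟩
end

section
/- Let A be a real n×n skew-symmetric matrix and let (λ, m) be a max-plus eigenpair of A. Then λ equals the L∞ distance from A to the subspace ST of strongly transitive matrices, i.e., λ = min over strongly transitive W of max_{i,j} |A_{ij} − W_{ij}|, and this minimum is attained. -/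
open Matrix

/-- A max-plus eigenpair `(lam, m)` of `A`: for every row `i`,
`max_j (A i j + m j) = lam + m i`. -/
def IsMaxPlusEigenpair {n : ℕ} (A : Matrix (Fin n) (Fin n) ℝ) (lam : ℝ)
    (m : Fin n → ℝ) : Prop :=
  ∀ i, (∀ j, A i j + m j ≤ lam + m i) ∧ (∃ j, A i j + m j = lam + m i)

theorem abs_sub_le_iSup_iSup {n : ℕ} (A W : Matrix (Fin n) (Fin n) ℝ) (i j : Fin n) :
    |A i j - W i j| ≤ ⨆ i, ⨆ j, |A i j - W i j| :=
  (le_ciSup (Set.finite_range fun j => |A i j - W i j|).bddAbove j).trans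
    (le_ciSup (Set.finite_range fun i => ⨆ j, |A i j - W i j|).bddAbove i)

/-- for a skew-symmetric A with max-plus eigenpair (lam, m), the
eigenvalue lam is the attained minimum of the L∞ distance max_{i,j}|A_{ij} − W_{ij}|
over strongly transitive matrices W. -/
theorem maxPlus_eigenvalue_is_Linfty_distance (n : ℕ) (hn : 0 < n)
    (A : Matrix (Fin n) (Fin n) ℝ) (hA : Aᵀ = -A)
    (lam : ℝ) (m : Fin n → ℝ) (h : IsMaxPlusEigenpair A lam m) :
    IsLeast {c : ℝ | ∃ W : Matrix (Fin n) (Fin n) ℝ, StronglyTransitive W ∧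
      c = ⨆ i, ⨆ j, |A i j - W i j|} lam := by
  have : Nonempty (Fin n) := ⟨⟨0, hn⟩⟩
  have skew : ∀ i j, A j i = -A i j := fun i j => congrFun (congrFun hA i) j
  constructor
  · refine ⟨fun i j => m i - m j, fun i j k => by ring, le_antisymm ?_ ?_⟩
    · obtain ⟨j, hj⟩ := (h ⟨0, hn⟩).2
      refine le_trans ?_ (abs_sub_le_iSup_iSup A (fun i j => m i - m j) ⟨0, hn⟩ j)
      exact le_trans (by linarith) (le_abs_self _)
    · refine ciSup_le fun i => ciSup_le fun j => abs_le.2 ⟨?_, ?_⟩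
      · linarith [(h j).1 i, skew i j]
      · linarith [(h i).1 j]
  · rintro c ⟨W, hW, rfl⟩
    obtain ⟨i, hi⟩ := Finite.exists_max fun i => m i - W i ⟨0, hn⟩
    obtain ⟨j, hj⟩ := (h i).2
    have hle := (le_abs_self _).trans (abs_sub_le_iSup_iSup A W i j)
    linarith [hi j, hW i j ⟨0, hn⟩]
end

section
/- Let A be a real n×n skew-symmetric matrix and let (λ, m) be a max-plus eigenpair of A. Then the strongly transitive matrix M defined by M_{ij} = m_i − m_j satisfies max_{i,j} |A_{ij} − M_{ij}| = λ; in particular, M is an L∞-minimizer from A to the subspace of strongly transitive matrices. -/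
open Matrix

/-- Every entry of a real matrix is bounded in absolute value by the supremum of the entries. -/
theorem abs_apply_le_iSup_iSup {n : ℕ} (B : Matrix (Fin n) (Fin n) ℝ) (i j : Fin n) :
    |B i j| ≤ ⨆ i, ⨆ j, |B i j| :=
  (le_ciSup (f := fun j => |B i j|) (Set.finite_range _).bddAbove j).trans
    (le_ciSup (f := fun i => ⨆ j, |B i j|) (Set.finite_range _).bddAbove i)

/-- The max-plus eigenvalue bounds from below the distance to any strongly transitive matrix. -/
theorem IsMaxPlusEigenpair.le_iSup_iSup_abs_sub {n : ℕ} (hn : 0 < n)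
    {A : Matrix (Fin n) (Fin n) ℝ} {lam : ℝ} {m : Fin n → ℝ} (h : IsMaxPlusEigenpair A lam m)
    {W : Matrix (Fin n) (Fin n) ℝ} (hW : StronglyTransitive W) :
    lam ≤ ⨆ i, ⨆ j, |A i j - W i j| := by
  have : Nonempty (Fin n) := ⟨⟨0, hn⟩⟩
  obtain ⟨i, hi⟩ := Finite.exists_min fun i => W i ⟨0, hn⟩ - m i
  obtain ⟨j, hj⟩ := (h i).2
  have hbound : |A i j - W i j| ≤ ⨆ i, ⨆ j, |A i j - W i j| :=
    abs_apply_le_iSup_iSup (A - W) i j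
  linarith [le_abs_self (A i j - W i j), hi j, hW i j ⟨0, hn⟩]

/-- if (lam, m) is a max-plus eigenpair of the skew-symmetric matrix A,
then the strongly transitive matrix M with M_{ij} = m_i − m_j is at L∞ distance
exactly lam from A, and it is an L∞ minimizer among strongly transitive matrices. -/
theorem maxPlus_eigenvector_gives_Linfty_minimizer (n : ℕ) (hn : 0 < n)
    (A : Matrix (Fin n) (Fin n) ℝ) (hA : Aᵀ = -A)
    (lam : ℝ) (m : Fin n → ℝ) (h : IsMaxPlusEigenpair A lam m)
    (M : Matrix (Fin n) (Fin n) ℝ) (hM : ∀ i j, M i j = m i - m j) :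
    StronglyTransitive M ∧
    (⨆ i, ⨆ j, |A i j - M i j|) = lam ∧
    ∀ W : Matrix (Fin n) (Fin n) ℝ, StronglyTransitive W →
      (⨆ i, ⨆ j, |A i j - M i j|) ≤ ⨆ i, ⨆ j, |A i j - W i j| := by
  have : Nonempty (Fin n) := ⟨⟨0, hn⟩⟩
  have hT : StronglyTransitive M := fun i j k => by rw [hM, hM, hM]; ring
  have hle : (⨆ i, ⨆ j, |A i j - M i j|) ≤ lam := by
    refine ciSup_le fun i => ciSup_le fun j => abs_le.2 ?_
    have hskew : A j i = -A i j := congrFun (congrFun hA i) j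
    rw [hM]
    constructor <;> linarith [(h i).1 j, (h j).1 i]
  exact ⟨hT, hle.antisymm (h.le_iSup_iSup_abs_sub hn hT),
    fun W hW => hle.trans (h.le_iSup_iSup_abs_sub hn hW)⟩
end

section
/- For each i ∈ {1,…,n} let T_i be the skew-symmetric n×n matrix with (T_i)_{ij} = 1 and (T_i)_{ji} = −1 for every j ≠ i, and all other entries 0. Then each T_i is strongly transitive, T_1 + … + T_n is not needed for independence in the following sense: any subset of n−1 matrices from {T_1,…,T_n} is a basis of the subspace ST of strongly transitive n×n matrices; in particular ST has dimension n−1. -/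
open Matrix

/-- The subspace of strongly transitive n×n real matrices
(`W i k = W i j + W j k` for all indices). -/
def STSubmodule (n : ℕ) : Submodule ℝ (Matrix (Fin n) (Fin n) ℝ) where
  carrier := {W | ∀ i j k, W i k = W i j + W j k}
  zero_mem' := by intro i j k; simp
  add_mem' := by
    intro a b ha hb i j k
    simp only [Matrix.add_apply, ha i j k, hb i j k]; ring
  smul_mem' := by
    intro c a ha i j k
    simp only [Matrix.smul_apply, smul_eq_mul, ha i j k]; ring

/-- The strongly transitive matrix `T_i` with `(T_i)_{ij} = 1`, `(T_i)_{ji} = -1`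
for `j ≠ i` and all other entries 0. -/
def Tmat (n : ℕ) (i : Fin n) : Matrix (Fin n) (Fin n) ℝ :=
  Matrix.of fun j k => (if j = i then (1 : ℝ) else 0) - (if k = i then 1 else 0)

theorem Tmat_mem_STSubmodule (n : ℕ) (i : Fin n) : Tmat n i ∈ STSubmodule n := by
  intro j k l
  simp only [Tmat, Matrix.of_apply]
  ring

theorem sum_smul_Tmat_apply {n : ℕ} (s : Finset (Fin n)) (c : Fin n → ℝ) (j k : Fin n) :
    (∑ i ∈ s, c i • Tmat n i) j k =
      (if j ∈ s then c j else 0) - (if k ∈ s then c k else 0) := by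
  simp [Matrix.sum_apply, Tmat, mul_sub, Finset.sum_sub_distrib]

theorem linearIndepOn_Tmat_of_notMem {n : ℕ} {s : Finset (Fin n)} {m : Fin n} (hm : m ∉ s) :
    LinearIndepOn ℝ (Tmat n) (s : Set (Fin n)) := by
  rw [linearIndepOn_finset_iff]
  intro c hc i hi
  simpa [hi, hm, hc] using (sum_smul_Tmat_apply s c i m).symm

theorem eq_sum_smul_Tmat_erase {n : ℕ} {W : Matrix (Fin n) (Fin n) ℝ}
    (hW : W ∈ STSubmodule n) (m : Fin n) :
    W = ∑ i ∈ Finset.univ.erase m, W i m • Tmat n i := by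
  have hdiag : W m m = 0 := by linarith [hW m m m]
  have hite (j : Fin n) : (if j ∈ Finset.univ.erase m then W j m else 0) = W j m := by
    by_cases h : j = m <;> simp [h, hdiag]
  ext j k
  rw [sum_smul_Tmat_apply, hite, hite]
  linarith [hW j k m]

theorem span_Tmat_erase (n : ℕ) (m : Fin n) :
    Submodule.span ℝ (Tmat n '' ↑(Finset.univ.erase m)) = STSubmodule n := by
  apply le_antisymm
  · rw [Submodule.span_le]
    rintro _ ⟨i, -, rfl⟩
    exact Tmat_mem_STSubmodule n i
  · intro W hW
    rw [eq_sum_smul_Tmat_erase hW m]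
    exact Submodule.sum_mem _ fun i hi =>
      Submodule.smul_mem _ _ (Submodule.subset_span ⟨i, hi, rfl⟩)

theorem exists_eq_univ_erase_of_card {n : ℕ} (hn : n ≠ 0) {s : Finset (Fin n)}
    (hs : s.card = n - 1) : ∃ m, s = Finset.univ.erase m := by
  have hc : sᶜ.card = 1 := by
    rw [Finset.card_compl, Fintype.card_fin]
    omega
  obtain ⟨m, hm⟩ := Finset.card_eq_one.mp hc
  refine ⟨m, ?_⟩
  rw [← compl_compl s, hm, Finset.compl_singleton]

/-- each `T_i` is strongly transitive, and any n−1 of the matrices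
`T_1, …, T_n` form a basis of the subspace of strongly transitive matrices;
in particular that subspace has dimension n−1. -/
theorem Tmat_basis_of_stronglyTransitive (n : ℕ) :
    (∀ i : Fin n, Tmat n i ∈ STSubmodule n) ∧
    (∀ s : Finset (Fin n), s.card = n - 1 →
      LinearIndependent ℝ (fun i : {x // x ∈ s} => Tmat n i.1) ∧
      Submodule.span ℝ (Tmat n '' ↑s) = STSubmodule n) ∧
    Module.finrank ℝ (STSubmodule n) = n - 1 := by
  rcases eq_or_ne n 0 with rfl | hn
  · exact ⟨fun i => i.elim0,
      fun s _ => ⟨linearIndependent_empty_type, Subsingleton.elim _ _⟩,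
      Module.finrank_zero_of_subsingleton⟩
  have hindep (m : Fin n) : LinearIndepOn ℝ (Tmat n) ↑(Finset.univ.erase m) :=
    linearIndepOn_Tmat_of_notMem (Finset.notMem_erase m _)
  refine ⟨Tmat_mem_STSubmodule n, fun s hs => ?_, ?_⟩
  · obtain ⟨m, rfl⟩ := exists_eq_univ_erase_of_card hn hs
    exact ⟨hindep m, span_Tmat_erase n m⟩
  · let m : Fin n := ⟨0, Nat.pos_of_ne_zero hn⟩
    have hcard := finrank_span_eq_card (hindep m)
    rw [← Set.image_eq_range, span_Tmat_erase] at hcard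
    simpa using hcard
end

section
/- For a cycle π = (i_1, …, i_k) of k ≥ 3 pairwise distinct indices in {1,…,n}, define the skew-symmetric n×n matrix S(π) by S(π)_{i_j i_{j+1}} = 1 and S(π)_{i_{j+1} i_j} = −1 for j = 1,…,k (indices taken cyclically, i_{k+1} = i_1), with all other entries 0. Then every S(π) is orthogonal (in the trace inner product) to every strongly transitive matrix, and the set of all matrices S(π), over all cycles π of length at least 3, spans the orthogonal complement of the subspace ST of strongly transitive matrices inside the space of skew-symmetric n×n matrices. -/
open Matrix

/-- The orthogonal complement (for the trace inner product) of the strongly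
transitive matrices inside the skew-symmetric n×n real matrices. -/
def STperp (n : ℕ) : Submodule ℝ (Matrix (Fin n) (Fin n) ℝ) where
  carrier := {A | Aᵀ = -A ∧ ∀ W : Matrix (Fin n) (Fin n) ℝ, StronglyTransitive W →
    Matrix.trace (Aᵀ * W) = 0}
  zero_mem' := ⟨by simp, fun W _ => by simp⟩
  add_mem' := by
    intro a b ha hb
    refine ⟨by rw [Matrix.transpose_add, ha.1, hb.1, neg_add], fun W hW => ?_⟩
    rw [Matrix.transpose_add, Matrix.add_mul, Matrix.trace_add, ha.2 W hW, hb.2 W hW,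
      add_zero]
  smul_mem' := by
    intro c a ha
    refine ⟨by rw [Matrix.transpose_smul, ha.1, smul_neg], fun W hW => ?_⟩
    rw [Matrix.transpose_smul, Matrix.smul_mul, Matrix.trace_smul, ha.2 W hW, smul_zero]

/-- The skew-symmetric matrix `S(π)` associated with a cycle `π = (c 0, …, c (k-1))`
of pairwise distinct indices: `S(π)_{i_j i_{j+1}} = 1`, `S(π)_{i_{j+1} i_j} = -1`
(indices cyclically), all other entries 0. -/
def cycMat (n k : ℕ) (c : Fin k → Fin n) : Matrix (Fin n) (Fin n) ℝ :=
  Matrix.of fun i j =>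
    ∑ t : Fin k, ((if i = c t ∧ j = c (finRotate k t) then (1 : ℝ) else 0) -
      (if i = c (finRotate k t) ∧ j = c t then 1 else 0))

/-- The skew-symmetric matrix of the directed edge from `a` to `b`. -/
def edgeMat {n : ℕ} (a b : Fin n) : Matrix (Fin n) (Fin n) ℝ :=
  Matrix.single a b 1 - Matrix.single b a 1

theorem edgeMat_self {n : ℕ} (a : Fin n) : edgeMat a a = 0 := sub_self _

theorem edgeMat_swap {n : ℕ} (a b : Fin n) : edgeMat b a = -edgeMat a b :=
  (neg_sub _ _).symm

theorem transpose_edgeMat {n : ℕ} (a b : Fin n) : (edgeMat a b)ᵀ = -edgeMat a b := by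
  simp [edgeMat]

theorem cycMat_eq_sum_edgeMat {n k : ℕ} (c : Fin k → Fin n) :
    cycMat n k c = ∑ t, edgeMat (c t) (c (finRotate k t)) := by
  ext i j
  simp only [cycMat, edgeMat, Matrix.of_apply, Matrix.sum_apply, Matrix.sub_apply,
    Matrix.single_apply, eq_comm]

theorem transpose_cycMat {n k : ℕ} (c : Fin k → Fin n) : (cycMat n k c)ᵀ = -cycMat n k c := by
  simp [cycMat_eq_sum_edgeMat, Matrix.transpose_sum, transpose_edgeMat]

theorem trace_transpose_edgeMat_mul {n : ℕ} (a b : Fin n) (W : Matrix (Fin n) (Fin n) ℝ) :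
    Matrix.trace ((edgeMat a b)ᵀ * W) = W a b - W b a := by
  simp [edgeMat, Matrix.sub_mul, Matrix.trace_single_mul]

theorem trace_transpose_cycMat_mul {n k : ℕ} (c : Fin k → Fin n)
    {W : Matrix (Fin n) (Fin n) ℝ} (hW : StronglyTransitive W) :
    Matrix.trace ((cycMat n k c)ᵀ * W) = 0 := by
  rw [cycMat_eq_sum_edgeMat, Matrix.transpose_sum, Matrix.sum_mul, Matrix.trace_sum]
  simp only [trace_transpose_edgeMat_mul]
  rcases isEmpty_or_nonempty (Fin k) with _ | ⟨⟨s⟩⟩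
  · simp
  · have key (t : Fin k) : W (c t) (c (finRotate k t)) - W (c (finRotate k t)) (c t)
        = 2 * W (c t) (c s) - 2 * W (c (finRotate k t)) (c s) := by
      linarith [hW (c t) (c (finRotate k t)) (c s), hW (c (finRotate k t)) (c t) (c s)]
    simp only [key]
    rw [Finset.sum_sub_distrib, Equiv.sum_comp (finRotate k) fun t => 2 * W (c t) (c s), sub_self]

theorem sum_row_eq_zero_of_mem_STperp {n : ℕ} {A : Matrix (Fin n) (Fin n) ℝ}
    (hA : A ∈ STperp n) (a : Fin n) : ∑ j, A a j = 0 := by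
  have skew (i j : Fin n) : A j i = -A i j := congrFun (congrFun hA.1 i) j
  have h := hA.2 (Matrix.of fun i j => (if i = a then 1 else 0) - (if j = a then 1 else 0))
    (fun i j k => by simp)
  simp only [Matrix.trace, Matrix.diag_apply, Matrix.mul_apply, Matrix.transpose_apply,
    Matrix.of_apply, mul_sub, mul_ite, mul_one, mul_zero, Finset.sum_sub_distrib,
    Finset.sum_ite_eq', Finset.mem_univ, if_true] at h
  rw [Finset.sum_comm (f := fun x i => if x = a then A i x else 0)] at h
  simp only [Finset.sum_ite_eq', Finset.mem_univ, if_true, skew a, Finset.sum_neg_distrib] at h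
  linarith

theorem sum_smul_edgeMat {n : ℕ} (A : Matrix (Fin n) (Fin n) ℝ) :
    ∑ i, ∑ j, A i j • edgeMat i j = A - Aᵀ := by
  have h : ∑ i, ∑ j, Matrix.single i j (A i j) = A := (Matrix.matrix_eq_sum_single A).symm
  have h_transpose : ∑ i, ∑ j, Matrix.single j i (A i j) = Aᵀ := by
    conv_rhs => rw [← h]
    simp [Matrix.transpose_sum]
  simp [edgeMat, smul_sub, Matrix.smul_single, Finset.sum_sub_distrib, h, h_transpose]

/-- A skew-symmetric matrix with vanishing row sums is a combination of triangles through `o`. -/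
theorem two_smul_eq_sum_triangle {n : ℕ} {A : Matrix (Fin n) (Fin n) ℝ}
    (hA : A ∈ STperp n) (o : Fin n) :
    (2 : ℝ) • A = ∑ i, ∑ j, A i j • (edgeMat o i + edgeMat i j + edgeMat j o) := by
  have skew (i j : Fin n) : A j i = -A i j := congrFun (congrFun hA.1 i) j
  have h₁ : ∑ i, ∑ j, A i j • edgeMat o i = 0 := by
    simp [← Finset.sum_smul, sum_row_eq_zero_of_mem_STperp hA]
  have h₂ : ∑ i, ∑ j, A i j • edgeMat j o = 0 := by
    rw [Finset.sum_comm]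
    have col (j : Fin n) : ∑ i, A i j = 0 := by
      simp only [skew j, Finset.sum_neg_distrib, sum_row_eq_zero_of_mem_STperp hA, neg_zero]
    simp [← Finset.sum_smul, col]
  simp only [smul_add, Finset.sum_add_distrib, h₁, h₂, sum_smul_edgeMat, hA.1]
  simp [two_smul]

theorem triangle_mem_span {n : ℕ} (o i j : Fin n) :
    edgeMat o i + edgeMat i j + edgeMat j o ∈
      Submodule.span ℝ {M : Matrix (Fin n) (Fin n) ℝ |
        ∃ k : ℕ, 3 ≤ k ∧ ∃ c : Fin k → Fin n, Function.Injective c ∧ M = cycMat n k c} := by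
  by_cases hoi : o = i
  · subst hoi
    simp [edgeMat_self, edgeMat_swap o j]
  by_cases hij : i = j
  · subst hij
    simp [edgeMat_self, edgeMat_swap o i]
  by_cases hjo : j = o
  · subst hjo
    simp [edgeMat_self, edgeMat_swap j i]
  refine Submodule.subset_span ⟨3, le_rfl, ![o, i, j], ?_, ?_⟩
  · intro a b hab
    fin_cases a <;> fin_cases b <;> simp_all [eq_comm]
  · simp [cycMat_eq_sum_edgeMat, Fin.sum_univ_three]

/-- every cycle matrix `S(π)` (for a cycle of length k ≥ 3 of pairwise
distinct indices) is trace-orthogonal to every strongly transitive matrix, and the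
set of all such cycle matrices spans the orthogonal complement of the strongly
transitive matrices inside the skew-symmetric matrices. -/
theorem cycle_matrices_span_STperp (n : ℕ) :
    (∀ k : ℕ, 3 ≤ k → ∀ c : Fin k → Fin n, Function.Injective c →
      ∀ W : Matrix (Fin n) (Fin n) ℝ, StronglyTransitive W →
        Matrix.trace ((cycMat n k c)ᵀ * W) = 0) ∧
    Submodule.span ℝ {M : Matrix (Fin n) (Fin n) ℝ |
        ∃ k : ℕ, 3 ≤ k ∧ ∃ c : Fin k → Fin n, Function.Injective c ∧ M = cycMat n k c}
      = STperp n := by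
  refine ⟨fun k _ c _ W hW => trace_transpose_cycMat_mul c hW, le_antisymm ?_ fun A hA => ?_⟩
  · rw [Submodule.span_le]
    rintro _ ⟨k, _, c, _, rfl⟩
    exact ⟨transpose_cycMat c, fun W hW => trace_transpose_cycMat_mul c hW⟩
  · rcases isEmpty_or_nonempty (Fin n) with _ | ⟨⟨o⟩⟩
    · rw [Subsingleton.elim A 0]
      exact Submodule.zero_mem _
    · rw [← Submodule.smul_mem_iff _ (two_ne_zero (α := ℝ)), two_smul_eq_sum_triangle hA o]
      exact Submodule.sum_mem _ fun i _ => Submodule.sum_mem _ fun j _ =>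
        Submodule.smul_mem _ _ (triangle_mem_span o i j)
end

section
/- Fix n ≥ 3 and a vertex v ∈ {1,…,n}. For each unordered pair {a,b} ⊆ {1,…,n}\{v}, choose one orientation of the 3-cycle through v, a, b and let S(v,a,b) be the associated skew-symmetric cycle matrix. The resulting (n−1 choose 2) matrices form a basis of the orthogonal complement of the subspace ST of strongly transitive matrices inside the space of skew-symmetric n×n matrices; in particular this orthogonal complement has dimension (n−1 choose 2). -/
open Matrix

/-- The skew-symmetric cycle matrix of the 3-cycle (v, a, b):
entries `(v,a)`, `(a,b)`, `(b,v)` equal 1, the transposed entries equal −1,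
and all other entries are 0 (for pairwise distinct v, a, b). -/
def cyc3 (n : ℕ) (v a b : Fin n) : Matrix (Fin n) (Fin n) ℝ :=
  Matrix.of fun i j =>
    (if i = v ∧ j = a then (1 : ℝ) else 0) + (if i = a ∧ j = b then 1 else 0) +
      (if i = b ∧ j = v then 1 else 0) - (if i = a ∧ j = v then 1 else 0) -
      (if i = b ∧ j = a then 1 else 0) - (if i = v ∧ j = b then 1 else 0)

theorem cyc3_swap (n : ℕ) (v a b : Fin n) : cyc3 n v b a = -cyc3 n v a b := by
  ext i j
  simp only [cyc3, of_apply, Matrix.neg_apply]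
  ring

theorem cyc3_transpose (n : ℕ) (v a b : Fin n) : (cyc3 n v a b)ᵀ = -cyc3 n v a b := by
  ext i j
  simp only [cyc3, of_apply, Matrix.neg_apply, transpose_apply, and_comm]
  ring

theorem trace_transpose_mul_eq_sum {n : ℕ} (A W : Matrix (Fin n) (Fin n) ℝ) :
    trace (Aᵀ * W) = ∑ i, ∑ j, A i j * W i j := by
  simp only [trace, diag_apply, mul_apply, transpose_apply]
  exact Finset.sum_comm

theorem sum_sum_ite_mul {n : ℕ} (W : Matrix (Fin n) (Fin n) ℝ) (a b : Fin n) :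
    ∑ i, ∑ j, (if i = a ∧ j = b then (1 : ℝ) else 0) * W i j = W a b := by
  simp [ite_and]

theorem cyc3_mem_STperp (n : ℕ) (v a b : Fin n) : cyc3 n v a b ∈ STperp n := by
  refine ⟨cyc3_transpose n v a b, fun W hW => ?_⟩
  rw [trace_transpose_mul_eq_sum]
  simp only [cyc3, of_apply, sub_mul, add_mul, Finset.sum_sub_distrib, Finset.sum_add_distrib,
    sum_sum_ite_mul]
  linarith [hW v a b, hW v b v, hW v v v, hW v a v, hW b a v, hW a b a, hW a a a, hW v b a]

/-- Matrices orthogonal to the strongly transitive ones have vanishing row sums. -/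
theorem row_sum_eq_zero_of_mem_STperp {n : ℕ} {A : Matrix (Fin n) (Fin n) ℝ}
    (hA : A ∈ STperp n) (k : Fin n) : ∑ j, A k j = 0 := by
  have hskew : ∀ i j, A j i = -A i j := fun i j => congrFun (congrFun hA.1 i) j
  have h := hA.2 (of fun i j => (if i = k then (1 : ℝ) else 0) - if j = k then 1 else 0)
    (fun i j l => by simp only [of_apply]; ring)
  rw [trace_transpose_mul_eq_sum] at h
  simp only [of_apply, mul_sub, Finset.sum_sub_distrib, mul_ite, mul_one, mul_zero,
    Finset.sum_ite_eq', Finset.mem_univ, if_true] at h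
  rw [Finset.sum_comm] at h
  simp only [Finset.sum_ite_eq', Finset.mem_univ, if_true, hskew k, Finset.sum_neg_distrib] at h
  linarith

/-- A matrix in `STperp n` is determined by its entries above the diagonal, off the row and
column of `v`. -/
theorem eq_zero_of_mem_STperp {n : ℕ} {A : Matrix (Fin n) (Fin n) ℝ} (hA : A ∈ STperp n)
    (v : Fin n) (h : ∀ i j, i < j → i ≠ v → j ≠ v → A i j = 0) : A = 0 := by
  have hskew : ∀ i j, A j i = -A i j := fun i j => congrFun (congrFun hA.1 i) j
  have hoff : ∀ i j, i ≠ v → j ≠ v → A i j = 0 := by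
    intro i j hi hj
    rcases lt_trichotomy i j with hij | rfl | hij
    · exact h i j hij hi hj
    · linarith [hskew i i]
    · rw [hskew j i, h j i hij hj hi, neg_zero]
  have hcol : ∀ i, A i v = 0 := by
    intro i
    by_cases hi : i = v
    · subst hi
      linarith [hskew i i]
    · rw [← row_sum_eq_zero_of_mem_STperp hA i]
      exact (Finset.sum_eq_single v (fun j _ hj => hoff i j hi hj) (by simp)).symm
  ext i j
  rw [Matrix.zero_apply]
  by_cases hj : j = v
  · rw [hj, hcol]
  by_cases hi : i = v
  · rw [hi, hskew j v, hcol, neg_zero]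
  · exact hoff i j hi hj

theorem cyc3_apply_of_ne {n : ℕ} {v : Fin n} {a b i j : Fin n} (hab : a < b) (hij : i < j)
    (hi : i ≠ v) (hj : j ≠ v) : cyc3 n v a b i j = if i = a ∧ j = b then 1 else 0 := by
  have h : ¬(i = b ∧ j = a) := by
    rintro ⟨rfl, rfl⟩
    exact lt_asymm hab hij
  simp [cyc3, hi, hj, h]

theorem card_ordered_pairs_ne {n : ℕ} (v : Fin n) :
    Fintype.card {p : Fin n × Fin n // p.1 < p.2 ∧ p.1 ≠ v ∧ p.2 ≠ v} = (n - 1).choose 2 := by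
  have hcard : (Finset.powersetCard 2 (Finset.univ.erase v)).card = (n - 1).choose 2 := by
    simp
  rw [Fintype.card_subtype, ← hcard]
  refine Finset.card_bij (fun p _ => {p.1, p.2}) ?_ ?_ ?_
  · rintro ⟨a, b⟩ hp
    simp only [Finset.mem_filter, Finset.mem_univ, true_and] at hp
    rw [Finset.mem_powersetCard]
    refine ⟨?_, Finset.card_pair hp.1.ne⟩
    intro x hx
    simp only [Finset.mem_insert, Finset.mem_singleton] at hx
    rcases hx with rfl | rfl <;> simp [hp.2]
  · rintro ⟨a, b⟩ hp ⟨c, d⟩ hq h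
    simp only [Finset.mem_filter, Finset.mem_univ, true_and] at hp hq
    have ha : a ∈ ({c, d} : Finset (Fin n)) := by rw [← h]; simp
    have hb : b ∈ ({c, d} : Finset (Fin n)) := by rw [← h]; simp
    simp only [Finset.mem_insert, Finset.mem_singleton] at ha hb
    grind
  · intro s hs
    rw [Finset.mem_powersetCard] at hs
    obtain ⟨a, b, hab, rfl⟩ := Finset.card_eq_two.mp hs.2
    have ha : a ≠ v := Finset.ne_of_mem_erase (hs.1 (by simp))
    have hb : b ≠ v := Finset.ne_of_mem_erase (hs.1 (by simp))
    rcases lt_or_gt_of_ne hab with hlt | hlt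
    · exact ⟨(a, b), by simp [hlt, ha, hb], rfl⟩
    · exact ⟨(b, a), by simp [hlt, ha, hb], Finset.pair_comm b a⟩

/-- fix n ≥ 3 and a vertex v. Choosing (via ε) one orientation of the
3-cycle through v, a, b for each unordered pair {a,b} of vertices different from v,
the resulting (n−1 choose 2) cycle matrices form a basis of the orthogonal complement
of the strongly transitive matrices inside the skew-symmetric matrices; in particular
that orthogonal complement has dimension (n−1 choose 2). -/
theorem three_cycles_through_vertex_basis_of_STperp (n : ℕ) (hn : 3 ≤ n) (v : Fin n)
    (ε : Fin n → Fin n → Bool) :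
    LinearIndependent ℝ
      (fun p : {p : Fin n × Fin n // p.1 < p.2 ∧ p.1 ≠ v ∧ p.2 ≠ v} =>
        if ε p.1.1 p.1.2 then cyc3 n v p.1.1 p.1.2 else cyc3 n v p.1.2 p.1.1) ∧
    Submodule.span ℝ (Set.range
      (fun p : {p : Fin n × Fin n // p.1 < p.2 ∧ p.1 ≠ v ∧ p.2 ≠ v} =>
        if ε p.1.1 p.1.2 then cyc3 n v p.1.1 p.1.2 else cyc3 n v p.1.2 p.1.1))
      = STperp n ∧
    Module.finrank ℝ (STperp n) = (n - 1).choose 2 := by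
  set f := fun p : {p : Fin n × Fin n // p.1 < p.2 ∧ p.1 ≠ v ∧ p.2 ≠ v} =>
    if ε p.1.1 p.1.2 then cyc3 n v p.1.1 p.1.2 else cyc3 n v p.1.2 p.1.1 with hf
  have hmem : ∀ p, f p ∈ STperp n := by
    intro p
    simp only [hf]
    split_ifs <;> exact cyc3_mem_STperp ..
  have happly : ∀ p q : {p : Fin n × Fin n // p.1 < p.2 ∧ p.1 ≠ v ∧ p.2 ≠ v},
      f p q.1.1 q.1.2 = if q = p then (if ε p.1.1 p.1.2 then (1 : ℝ) else -1) else 0 := by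
    intro p q
    have hentry := cyc3_apply_of_ne p.2.1 q.2.1 q.2.2.1 q.2.2.2
    have hpq : q = p ↔ q.1.1 = p.1.1 ∧ q.1.2 = p.1.2 := by
      rw [Subtype.ext_iff, Prod.ext_iff]
    simp only [hf, hpq]
    rcases ε p.1.1 p.1.2 with _ | _
    · simp only [Bool.false_eq_true, if_false]
      rw [cyc3_swap, Matrix.neg_apply, hentry]
      split_ifs <;> simp
    · simp only [if_true]
      exact hentry
  have hsum : ∀ (c : {p : Fin n × Fin n // p.1 < p.2 ∧ p.1 ≠ v ∧ p.2 ≠ v} → ℝ) q,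
      (∑ p, c p • f p) q.1.1 q.1.2 = c q * if ε q.1.1 q.1.2 then (1 : ℝ) else -1 := by
    intro c q
    simp [Matrix.sum_apply, happly]
  have hli : LinearIndependent ℝ f := by
    rw [Fintype.linearIndependent_iff]
    intro c hc q
    have h := hsum c q
    rw [hc, Matrix.zero_apply] at h
    split_ifs at h <;> linarith
  have hspan : Submodule.span ℝ (Set.range f) = STperp n := by
    apply le_antisymm
    · rw [Submodule.span_le]
      rintro _ ⟨p, rfl⟩
      exact hmem p
    · intro A hA
      let c : {p : Fin n × Fin n // p.1 < p.2 ∧ p.1 ≠ v ∧ p.2 ≠ v} → ℝ :=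
        fun p => A p.1.1 p.1.2 * if ε p.1.1 p.1.2 then (1 : ℝ) else -1
      have hA_eq : A = ∑ p, c p • f p := by
        rw [← sub_eq_zero]
        refine eq_zero_of_mem_STperp (Submodule.sub_mem _ hA
          (Submodule.sum_mem _ fun p _ => Submodule.smul_mem _ _ (hmem p))) v ?_
        intro i j hij hi hj
        have h := hsum c ⟨(i, j), hij, hi, hj⟩
        simp only [c] at h
        rw [Matrix.sub_apply, h]
        split_ifs <;> ring
      rw [hA_eq]
      exact Submodule.sum_mem _ fun p _ =>
        Submodule.smul_mem _ _ (Submodule.subset_span ⟨p, rfl⟩)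
  refine ⟨hli, hspan, ?_⟩
  rw [← hspan, finrank_span_eq_card hli, card_ordered_pairs_ne]
end

section
/- Let A be a real n×n skew-symmetric matrix whose row sums are all zero (so its HodgeRank vector is 0), and suppose A has a max-plus eigenvector m, unique up to adding a constant to all coordinates, whose entries are pairwise distinct. Then for every permutation σ of {1,…,n} there exists a real n×n skew-symmetric matrix B such that the HodgeRank vector h(B) = (1/n)·B·1 satisfies h(B)_{σ(1)} > h(B)_{σ(2)} > … > h(B)_{σ(n)}, and B has a max-plus eigenvector, unique up to additive constants, inducing the same strict ordering of {1,…,n} as m. -/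
open Matrix

/-- Adding the gradient of `v` to `A` translates the max-plus eigenvectors of `A` by `v`. -/
theorem isMaxPlusEigenpair_add_gradient_iff {n : ℕ} (A : Matrix (Fin n) (Fin n) ℝ)
    (v : Fin n → ℝ) (lam : ℝ) (m : Fin n → ℝ) :
    IsMaxPlusEigenpair (Matrix.of fun i j => A i j + (v i - v j)) lam m ↔
      IsMaxPlusEigenpair A lam (m - v) := by
  have hle : ∀ i j, A i j + (v i - v j) + m j ≤ lam + m i ↔
      A i j + (m j - v j) ≤ lam + (m i - v i) := fun i j => by
    constructor <;> intro h <;> linarith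
  have heq : ∀ i j, A i j + (v i - v j) + m j = lam + m i ↔
      A i j + (m j - v j) = lam + (m i - v i) := fun i j => by
    constructor <;> intro h <;> linarith
  simp only [IsMaxPlusEigenpair, Matrix.of_apply, Pi.sub_apply, hle, heq]

/-- A small perturbation of a vector with pairwise distinct entries has the same ordering. -/
theorem exists_pos_lt_iff_add_smul_lt {ι : Type*} [Finite ι] {m : ι → ℝ}
    (hm : Function.Injective m) (v : ι → ℝ) :
    ∃ ε : ℝ, 0 < ε ∧ ∀ i j, m i < m j ↔ (m + ε • v) i < (m + ε • v) j := by
  have hev : ∀ᶠ ε : ℝ in nhdsWithin 0 (Set.Ioi 0),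
      ∀ i j, m i < m j → (m + ε • v) i < (m + ε • v) j := by
    refine Filter.Eventually.filter_mono nhdsWithin_le_nhds ?_
    refine Filter.eventually_all.2 fun i => Filter.eventually_all.2 fun j => ?_
    by_cases h : m i < m j
    · have hcont : ∀ k, Continuous fun ε : ℝ => (m + ε • v) k := fun k => by
        simp only [Pi.add_apply, Pi.smul_apply, smul_eq_mul]
        fun_prop
      filter_upwards [(hcont i).continuousAt.eventually_lt (hcont j).continuousAt
        (by simpa using h)] with ε hε _ using hε
    · exact Filter.Eventually.of_forall fun _ h' => absurd h' h
  obtain ⟨ε, hε, hpos⟩ := (hev.and self_mem_nhdsWithin).exists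
  refine ⟨ε, hpos, fun i j => ⟨hε i j, fun h => ?_⟩⟩
  rcases lt_trichotomy (m i) (m j) with h' | h' | h'
  · exact h'
  · exact absurd h (by simp [hm h'])
  · exact absurd h (hε j i h').not_gt

/-- let A be skew-symmetric with all row sums zero (HodgeRank
vector 0), having a max-plus eigenvector m, unique up to additive constants, with
pairwise distinct entries. Then for every permutation σ there is a skew-symmetric
matrix B whose HodgeRank vector is strictly decreasing along σ, and which has a
max-plus eigenvector, unique up to additive constants, inducing the same strict
ordering of the items as m. -/
theorem hodge_vs_tropical_from_one_matrix (n : ℕ)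
    (A : Matrix (Fin n) (Fin n) ℝ) (hA : Aᵀ = -A)
    (hrow : ∀ i, ∑ j, A i j = 0)
    (lam : ℝ) (m : Fin n → ℝ) (hm : IsMaxPlusEigenpair A lam m)
    (huniq : ∀ lam' : ℝ, ∀ m' : Fin n → ℝ, IsMaxPlusEigenpair A lam' m' →
      ∃ c : ℝ, ∀ i, m' i = m i + c)
    (hdist : Function.Injective m) :
    ∀ σ : Equiv.Perm (Fin n), ∃ B : Matrix (Fin n) (Fin n) ℝ, Bᵀ = -B ∧
      (∀ i j : Fin n, i < j → hodgeVec B (σ j) < hodgeVec B (σ i)) ∧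
      ∃ mu : ℝ, ∃ mB : Fin n → ℝ, IsMaxPlusEigenpair B mu mB ∧
        (∀ mu' : ℝ, ∀ m' : Fin n → ℝ, IsMaxPlusEigenpair B mu' m' →
          ∃ c : ℝ, ∀ i, m' i = mB i + c) ∧
        (∀ i j : Fin n, m i < m j ↔ mB i < mB j) := by
  intro σ
  let v : Fin n → ℝ := fun i => -((σ.symm i : ℕ) : ℝ)
  obtain ⟨ε, hε, hord⟩ := exists_pos_lt_iff_add_smul_lt hdist v
  refine ⟨Matrix.of fun i j => A i j + ((ε • v) i - (ε • v) j), ?_, ?_, lam, m + ε • v,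
    ?_, ?_, hord⟩
  · ext i j
    have h : A j i = -A i j := congrFun (congrFun hA i) j
    simp only [Matrix.transpose_apply, Matrix.of_apply, Matrix.neg_apply, h]
    ring
  · intro i j hij
    have hn : (0 : ℝ) < n := by exact_mod_cast i.pos
    have hlt : (ε • v) (σ j) < (ε • v) (σ i) := by
      simp only [v, Pi.smul_apply, smul_eq_mul, Equiv.symm_apply_apply]
      gcongr
      exact hij
    simp only [hodgeVec, Matrix.of_apply, Finset.sum_add_distrib, Finset.sum_sub_distrib, hrow,
      Finset.sum_const, Finset.card_univ, Fintype.card_fin, nsmul_eq_mul]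
    gcongr
  · rw [isMaxPlusEigenpair_add_gradient_iff, add_sub_cancel_right]
    exact hm
  · intro mu m' h
    obtain ⟨c, hc⟩ := huniq mu _ ((isMaxPlusEigenpair_add_gradient_iff A _ mu m').1 h)
    refine ⟨c, fun i => ?_⟩
    have := hc i
    simp only [Pi.sub_apply, Pi.add_apply] at this ⊢
    linarith
end

section
/- Let X be a real n×n matrix with all entries positive and X_{ij}·X_{ji} = 1 for all i, j, such that the all-ones vector is a max-times eigenvector of X, unique up to positive scaling, and such that the positive (Perron) eigenvector of X has pairwise distinct entries. Then for every permutation σ of {1,…,n} there exists a real n×n matrix Y with positive entries and Y_{ij}·Y_{ji} = 1 whose max-times eigenvector (unique up to positive scaling) induces the ranking σ and whose positive (Perron) eigenvector induces the same ranking as the Perron eigenvector of X. -/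
open Matrix

/-- A max-times eigenpair `(lam, v)` of a positive matrix X: lam > 0, v positive, and
`max_j X i j * v j = lam * v i` for every row i. -/
def IsMaxTimesEigenpair {n : ℕ} (X : Matrix (Fin n) (Fin n) ℝ) (lam : ℝ)
    (v : Fin n → ℝ) : Prop :=
  0 < lam ∧ (∀ i, 0 < v i) ∧
    ∀ i, (∀ j, X i j * v j ≤ lam * v i) ∧ (∃ j, X i j * v j = lam * v i)

section

open Filter Topology

/-- Rescaling a max-times eigenpair by a positive diagonal conjugation. -/
theorem IsMaxTimesEigenpair.diagonal_conj {n : ℕ} {X : Matrix (Fin n) (Fin n) ℝ} {lam : ℝ}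
    {v d : Fin n → ℝ} (h : IsMaxTimesEigenpair X lam v) (hd : ∀ i, 0 < d i) :
    IsMaxTimesEigenpair (Matrix.of fun i j => d i * X i j * (d j)⁻¹) lam (fun i => d i * v i) := by
  obtain ⟨hlam, hv, hmax⟩ := h
  have key : ∀ i j, d i * X i j * (d j)⁻¹ * (d j * v j) = d i * (X i j * v j) := by
    intro i j
    have := (hd j).ne'
    field_simp
  refine ⟨hlam, fun i => mul_pos (hd i) (hv i), fun i => ⟨fun j => ?_, ?_⟩⟩
  · rw [Matrix.of_apply, key, mul_left_comm lam]
    exact mul_le_mul_of_nonneg_left ((hmax i).1 j) (hd i).le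
  · obtain ⟨j, hj⟩ := (hmax i).2
    exact ⟨j, by rw [Matrix.of_apply, key, hj, mul_left_comm]⟩

/-- Multiplying an injective family by sufficiently small exponential weights preserves its
order. -/
theorem exists_exp_smul_lt_iff {ι : Type*} [Finite ι] (a u : ι → ℝ) (hu : Function.Injective u) :
    ∃ ε : ℝ, 0 < ε ∧
      ∀ i j, u i < u j ↔ Real.exp (-(ε * a i)) * u i < Real.exp (-(ε * a j)) * u j := by
  have hev : ∀ᶠ ε : ℝ in 𝓝 0, ∀ i j, u i < u j →
      Real.exp (-(ε * a i)) * u i < Real.exp (-(ε * a j)) * u j := by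
    refine eventually_all.2 fun i => eventually_all.2 fun j => ?_
    by_cases hij : u i < u j
    · have hcont : ∀ k, Continuous fun ε : ℝ => Real.exp (-(ε * a k)) * u k := by
        intro k
        fun_prop
      filter_upwards [(hcont i).continuousAt.eventually_lt (hcont j).continuousAt
        (by simpa using hij)] with ε hε _ using hε
    · exact Eventually.of_forall fun _ h => absurd h hij
  obtain ⟨ε, hε, hpos⟩ :=
    ((hev.filter_mono nhdsWithin_le_nhds).and (self_mem_nhdsWithin (s := Set.Ioi 0))).exists
  refine ⟨ε, hpos, fun i j => ⟨hε i j, fun h => ?_⟩⟩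
  rcases lt_trichotomy (u i) (u j) with hlt | heq | hgt
  · exact hlt
  · exact absurd h (by rw [hu heq]; exact lt_irrefl _)
  · exact absurd h (hε j i hgt).not_gt


end

/-- let X be an MPCM (positive entries, X_{ij}·X_{ji} = 1) whose
max-times eigenvector is the all-ones vector, unique up to positive scaling, and
whose Perron eigenvector has pairwise distinct entries. Then for every permutation σ
there is an MPCM Y whose max-times eigenvector (unique up to positive scaling)
induces the ranking σ and whose Perron eigenvector induces the same ranking as the
Perron eigenvector of X. -/
theorem tropical_vs_perron_from_one_matrix (n : ℕ)
    (X : Matrix (Fin n) (Fin n) ℝ) (hpos : ∀ i j, 0 < X i j)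
    (hrec : ∀ i j, X i j * X j i = 1)
    (lam : ℝ) (h1 : IsMaxTimesEigenpair X lam (fun _ => 1))
    (huniq : ∀ lam' : ℝ, ∀ v : Fin n → ℝ, IsMaxTimesEigenpair X lam' v →
      ∃ c : ℝ, 0 < c ∧ ∀ i, v i = c)
    (ρ : ℝ) (u : Fin n → ℝ) (hu : X.mulVec u = ρ • u) (hupos : ∀ i, 0 < u i)
    (hudist : Function.Injective u) :
    ∀ σ : Equiv.Perm (Fin n), ∃ Y : Matrix (Fin n) (Fin n) ℝ,
      (∀ i j, 0 < Y i j) ∧ (∀ i j, Y i j * Y j i = 1) ∧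
      (∃ mu : ℝ, ∃ w : Fin n → ℝ, IsMaxTimesEigenpair Y mu w ∧
        (∀ mu' : ℝ, ∀ w' : Fin n → ℝ, IsMaxTimesEigenpair Y mu' w' →
          ∃ c : ℝ, 0 < c ∧ ∀ i, w' i = c * w i) ∧
        (∀ i j : Fin n, i < j → w (σ j) < w (σ i))) ∧
      ∃ ρ' : ℝ, ∃ u' : Fin n → ℝ, Y.mulVec u' = ρ' • u' ∧ (∀ i, 0 < u' i) ∧
        (∀ i j : Fin n, u i < u j ↔ u' i < u' j) := by
  intro σ
  obtain ⟨ε, hε, hord⟩ := exists_exp_smul_lt_iff (fun k => ((σ.symm k : ℕ) : ℝ)) u hudist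
  set d : Fin n → ℝ := fun k => Real.exp (-(ε * ((σ.symm k : ℕ) : ℝ))) with hd
  have hdpos : ∀ k, 0 < d k := fun k => Real.exp_pos _
  refine ⟨Matrix.of fun i j => d i * X i j * (d j)⁻¹, fun i j => ?_, fun i j => ?_,
    ⟨lam, d, ?_, fun mu' w' hw' => ?_, fun i j hij => ?_⟩,
    ρ, fun i => d i * u i, ?_, fun i => mul_pos (hdpos i) (hupos i), hord⟩
  · exact mul_pos (mul_pos (hdpos i) (hpos i j)) (inv_pos.2 (hdpos j))
  · have hi := (hdpos i).ne'
    have hj := (hdpos j).ne'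
    simp only [Matrix.of_apply]
    field_simp
    exact hrec i j
  · simpa using h1.diagonal_conj hdpos
  · have hback := hw'.diagonal_conj (d := fun i => (d i)⁻¹) fun i => inv_pos.2 (hdpos i)
    have hX : (Matrix.of fun i j => (d i)⁻¹ *
        (Matrix.of fun i j => d i * X i j * (d j)⁻¹) i j * ((d j)⁻¹)⁻¹) = X := by
      ext i j
      have hi := (hdpos i).ne'
      have hj := (hdpos j).ne'
      simp only [Matrix.of_apply]
      field_simp
    rw [hX] at hback
    obtain ⟨c, hc, hcv⟩ := huniq _ _ hback
    refine ⟨c, hc, fun i => ?_⟩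
    have hi := (hdpos i).ne'
    rw [← hcv i]
    field_simp
  · have hij' : ((i : ℕ) : ℝ) < ((j : ℕ) : ℝ) := by exact_mod_cast hij
    simp only [hd, Equiv.symm_apply_apply, Real.exp_lt_exp, neg_lt_neg_iff]
    exact mul_lt_mul_of_pos_left hij' hε
  · ext i
    have hui := congrFun hu i
    simp only [Matrix.mulVec, dotProduct, Pi.smul_apply, smul_eq_mul, Matrix.of_apply] at hui ⊢
    rw [mul_left_comm, ← hui, Finset.mul_sum]
    refine Finset.sum_congr rfl fun j _ => ?_
    have hj := (hdpos j).ne'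
    field_simp
end

section
/- For every n ≥ 4 and every pair of permutations σ₁, σ₂ of {1,…,n}, there exists a real n×n skew-symmetric matrix A such that: (a) the HodgeRank vector h = (1/n)·A·1 satisfies h_{σ₁(1)} > h_{σ₁(2)} > … > h_{σ₁(n)}; and (b) A has a max-plus eigenvector m, unique up to adding a constant to all coordinates, satisfying m_{σ₂(1)} > m_{σ₂(2)} > … > m_{σ₂(n)}. -/
open Matrix

/-- The part above the diagonal of `cyclicTournament`. -/
noncomputable def cyclicTournamentUpper (m i j : ℕ) : ℝ :=
  if i = 0 then (if j = 1 then 1 else if j = m + 2 then -1 else 3 / 4)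
  else if j = m + 2 then 1 else 1 / 2

/-- A skew-symmetric array on the indices `0, …, m + 2` with entries at most `1`. The entries equal
to `1` are those at `(0, 1)`, `(m + 2, 0)` and `(i, m + 2)` for `0 < i < m + 2`. -/
noncomputable def cyclicTournament (m i j : ℕ) : ℝ :=
  if i < j then cyclicTournamentUpper m i j
  else if j < i then -cyclicTournamentUpper m j i else 0

theorem cyclicTournament_neg (m i j : ℕ) :
    cyclicTournament m j i = -cyclicTournament m i j := by
  unfold cyclicTournament
  rcases lt_trichotomy i j with h | h | h
  · simp [h, h.not_gt]
  · simp [h]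
  · simp [h, h.not_gt]

theorem cyclicTournament_le_one (m i j : ℕ) : cyclicTournament m i j ≤ 1 := by
  unfold cyclicTournament cyclicTournamentUpper
  split_ifs <;> norm_num

theorem cyclicTournament_zero_one (m : ℕ) : cyclicTournament m 0 1 = 1 := by
  simp [cyclicTournament, cyclicTournamentUpper]

theorem cyclicTournament_last_zero (m : ℕ) : cyclicTournament m (m + 2) 0 = 1 := by
  simp [cyclicTournament, cyclicTournamentUpper]

theorem cyclicTournament_last {m i : ℕ} (hi : 0 < i) (him : i < m + 2) :
    cyclicTournament m i (m + 2) = 1 := by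
  simp [cyclicTournament, cyclicTournamentUpper, him, hi.ne']

theorem eq_last_of_cyclicTournament_eq_one {m i j : ℕ} (hi : 0 < i) (him : i < m + 2)
    (h : cyclicTournament m i j = 1) : j = m + 2 := by
  unfold cyclicTournament cyclicTournamentUpper at h
  split_ifs at h <;> first | omega | (exfalso; norm_num at h)

theorem sum_range_add_three (m : ℕ) (f : ℕ → ℝ) :
    ∑ j ∈ Finset.range (m + 3), f j
      = f 0 + f 1 + ∑ j ∈ Finset.range m, f (j + 2) + f (m + 2) := by
  rw [Finset.sum_range_succ, Finset.sum_range_succ', Finset.sum_range_succ']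
  ring

theorem sum_cyclicTournament_zero (m : ℕ) :
    ∑ j ∈ Finset.range (m + 3), cyclicTournament m 0 j = 3 / 4 * m := by
  have h : ∀ j ∈ Finset.range m, cyclicTournament m 0 (j + 2) = 3 / 4 := by
    intro j hj
    have := Finset.mem_range.1 hj
    simp [cyclicTournament, cyclicTournamentUpper, this.ne]
  rw [sum_range_add_three, Finset.sum_congr rfl h]
  simp [cyclicTournament, cyclicTournamentUpper]
  ring

theorem sum_cyclicTournament_one (m : ℕ) :
    ∑ j ∈ Finset.range (m + 3), cyclicTournament m 1 j = 1 / 2 * m := by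
  have h : ∀ j ∈ Finset.range m, cyclicTournament m 1 (j + 2) = 1 / 2 := by
    intro j hj
    have := Finset.mem_range.1 hj
    simp [cyclicTournament, cyclicTournamentUpper, this.ne]
  rw [sum_range_add_three, Finset.sum_congr rfl h]
  simp [cyclicTournament, cyclicTournamentUpper]
  ring

theorem sum_cyclicTournament_last (m : ℕ) :
    ∑ j ∈ Finset.range (m + 3), cyclicTournament m (m + 2) j = -m := by
  have h : ∀ j ∈ Finset.range m, cyclicTournament m (m + 2) (j + 2) = -1 := by
    intro j hj
    have := Finset.mem_range.1 hj
    simp [cyclicTournament, cyclicTournamentUpper, this, this.not_gt]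
  rw [sum_range_add_three, Finset.sum_congr rfl h]
  simp [cyclicTournament, cyclicTournamentUpper]

theorem cyclicTournament_add_two {m i j : ℕ} (hi : i < m) (hj : j < m) :
    cyclicTournament m (i + 2) (j + 2) = if i < j then 1 / 2 else if j < i then -(1 / 2) else 0 := by
  simp [cyclicTournament, cyclicTournamentUpper, hi.ne, hj.ne]

theorem sum_cyclicTournament_add_two {m i : ℕ} (hi : i < m) :
    ∑ j ∈ Finset.range (m + 3), cyclicTournament m (i + 2) j
      = -(1 / 4) + ∑ j ∈ Finset.range m,
          (if i < j then 1 / 2 else if j < i then -(1 / 2) else 0 : ℝ) := by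
  rw [sum_range_add_three, Finset.sum_congr rfl
    fun j hj => cyclicTournament_add_two hi (Finset.mem_range.1 hj),
    cyclicTournament_last (by omega) (by omega)]
  have h0 : cyclicTournament m (i + 2) 0 = -(3 / 4) := by
    simp [cyclicTournament, cyclicTournamentUpper, hi.ne]
  have h1 : cyclicTournament m (i + 2) 1 = -(1 / 2) := by
    simp [cyclicTournament, cyclicTournamentUpper, hi.ne]
  rw [h0, h1]
  ring

theorem sum_cyclicTournament_add_two_le {m i : ℕ} (hi : i < m) :
    ∑ j ∈ Finset.range (m + 3), cyclicTournament m (i + 2) j ≤ 1 / 2 * m - 1 / 4 := by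
  have h : ∑ j ∈ Finset.range m, (if i < j then 1 / 2 else if j < i then -(1 / 2) else 0 : ℝ)
      ≤ ∑ j ∈ Finset.range m, (1 / 2 : ℝ) := by
    refine Finset.sum_le_sum fun j _ => ?_
    split_ifs <;> norm_num
  rw [sum_cyclicTournament_add_two hi]
  rw [Finset.sum_const, Finset.card_range, nsmul_eq_mul] at h
  linarith

theorem le_sum_cyclicTournament_add_two {m i : ℕ} (hi : i < m) :
    -(1 / 2 * m) - 1 / 4 ≤ ∑ j ∈ Finset.range (m + 3), cyclicTournament m (i + 2) j := by
  have h : ∑ j ∈ Finset.range m, (-(1 / 2) : ℝ)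
      ≤ ∑ j ∈ Finset.range m, (if i < j then 1 / 2 else if j < i then -(1 / 2) else 0 : ℝ) := by
    refine Finset.sum_le_sum fun j _ => ?_
    split_ifs <;> norm_num
  rw [sum_cyclicTournament_add_two hi]
  rw [Finset.sum_const, Finset.card_range, nsmul_eq_mul] at h
  linarith

theorem sum_cyclicTournament_add_two_gap {m i j : ℕ} (hij : i < j) (hj : j < m) :
    ∑ k ∈ Finset.range (m + 3), cyclicTournament m (j + 2) k + 1 / 2
      ≤ ∑ k ∈ Finset.range (m + 3), cyclicTournament m (i + 2) k := by
  rw [sum_cyclicTournament_add_two hj, sum_cyclicTournament_add_two (hij.trans hj)]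
  have h := Finset.single_le_sum (s := Finset.range m) (a := i)
    (f := fun k => (if i < k then 1 / 2 else if k < i then -(1 / 2) else 0 : ℝ)
      - (if j < k then 1 / 2 else if k < j then -(1 / 2) else 0 : ℝ))
    (fun k _ => by
      split_ifs <;> first | omega | norm_num)
    (Finset.mem_range.2 (hij.trans hj))
  simp only [Finset.sum_sub_distrib, lt_irrefl, if_false, hij, hij.not_gt, if_true] at h
  linarith

/-- The row sums of `cyclicTournament` decrease by at least `1 / 4` at each step. -/
theorem sum_cyclicTournament_gap {m i j : ℕ} (hm : 1 ≤ m) (hij : i < j) (hj : j < m + 3) :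
    ∑ k ∈ Finset.range (m + 3), cyclicTournament m j k + 1 / 4
      ≤ ∑ k ∈ Finset.range (m + 3), cyclicTournament m i k := by
  have hm' : (1 : ℝ) ≤ m := by exact_mod_cast hm
  have h0 := sum_cyclicTournament_zero m
  have h1 := sum_cyclicTournament_one m
  have hl := sum_cyclicTournament_last m
  rcases (show j = m + 2 ∨ j = 1 ∨ ∃ b, b < m ∧ j = b + 2 by
    by_cases h : j = m + 2
    · exact Or.inl h
    by_cases h' : j = 1
    · exact Or.inr (Or.inl h')
    · exact Or.inr (Or.inr ⟨j - 2, by omega, by omega⟩)) with rfl | rfl | ⟨b, hb, rfl⟩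
  · rcases (show i = 0 ∨ i = 1 ∨ ∃ a, i = a + 2 by
      rcases i with _ | _ | a <;> simp) with rfl | rfl | ⟨a, rfl⟩
    · linarith
    · linarith
    · linarith [le_sum_cyclicTournament_add_two (m := m) (i := a) (by omega)]
  · obtain rfl : i = 0 := by omega
    linarith
  · rcases (show i = 0 ∨ i = 1 ∨ ∃ a, i = a + 2 by
      rcases i with _ | _ | a <;> simp) with rfl | rfl | ⟨a, rfl⟩
    · linarith [sum_cyclicTournament_add_two_le hb]
    · linarith [sum_cyclicTournament_add_two_le hb]
    · linarith [sum_cyclicTournament_add_two_gap (m := m) (i := a) (j := b) (by omega) hb]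

/-- The max-plus eigenvectors of a positive multiple of `cyclicTournament` are constant. -/
theorem IsMaxPlusEigenpair.eq_const_of_cyclicTournament {m : ℕ} {K lam : ℝ} (hK : 0 < K)
    {v : Fin (m + 3) → ℝ}
    (h : IsMaxPlusEigenpair (Matrix.of fun i j : Fin (m + 3) => K * cyclicTournament m i j) lam v) :
    ∃ c : ℝ, ∀ i, v i = c := by
  unfold IsMaxPlusEigenpair at h
  simp only [Matrix.of_apply] at h
  have hB (i j : ℕ) : K * cyclicTournament m i j ≤ K := by
    nlinarith [cyclicTournament_le_one m i j]
  let a : Fin (m + 3) := ⟨0, by omega⟩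
  let b : Fin (m + 3) := ⟨1, by omega⟩
  let l : Fin (m + 3) := ⟨m + 2, by omega⟩
  have hab := (h a).1 b
  have hbl := (h b).1 l
  have hla := (h l).1 a
  rw [show cyclicTournament m a b = 1 from cyclicTournament_zero_one m] at hab
  rw [show cyclicTournament m l a = 1 from cyclicTournament_last_zero m] at hla
  rw [show cyclicTournament m b l = 1 from
    cyclicTournament_last Nat.one_pos (by simp [b])] at hbl
  obtain ⟨i, hi⟩ := Finite.exists_max v
  obtain ⟨j, hj⟩ := (h i).2
  have hlam : lam = K := by linarith [hB i j, hi j]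
  subst hlam
  have hij : cyclicTournament m i j = 1 := by
    have h1 : lam ≤ lam * cyclicTournament m i j := by linarith [hi j]
    have h2 : 1 ≤ cyclicTournament m i j := by
      by_contra hlt
      nlinarith
    exact le_antisymm (cyclicTournament_le_one m i j) h2
  have hcases (k : Fin (m + 3)) : k = a ∨ k = b ∨ k = l ∨ (0 < k.1 ∧ k.1 < m + 2) := by
    have := k.is_lt
    simp only [Fin.ext_iff, a, b, l]
    omega
  have hmax : v i = v l := by
    rcases hcases i with rfl | rfl | rfl | ⟨h0, h1⟩
    · linarith
    · linarith
    · rfl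
    · have hjl : j = l := Fin.ext (eq_last_of_cyclicTournament_eq_one h0 h1 hij)
      rw [hij, hjl] at hj
      linarith
  refine ⟨v l, fun k => le_antisymm (hmax ▸ hi k) ?_⟩
  rcases hcases k with rfl | rfl | rfl | ⟨h0, h1⟩
  · linarith
  · linarith
  · rfl
  · have hkl := (h k).1 l
    rw [show cyclicTournament m k l = 1 from cyclicTournament_last h0 h1] at hkl
    linarith

/-- for every n ≥ 4 and every pair of rankings σ₁, σ₂ there is a
skew-symmetric n×n matrix A whose HodgeRank vector induces the ranking σ₁ and
which has a max-plus eigenvector, unique up to additive constants, inducing the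
ranking σ₂. -/
theorem hodge_tropical_arbitrary_rankings (n : ℕ) (hn : 4 ≤ n)
    (σ₁ σ₂ : Equiv.Perm (Fin n)) :
    ∃ A : Matrix (Fin n) (Fin n) ℝ, Aᵀ = -A ∧
      (∀ i j : Fin n, i < j → hodgeVec A (σ₁ j) < hodgeVec A (σ₁ i)) ∧
      ∃ lam : ℝ, ∃ m : Fin n → ℝ, IsMaxPlusEigenpair A lam m ∧
        (∀ lam' : ℝ, ∀ m' : Fin n → ℝ, IsMaxPlusEigenpair A lam' m' →
          ∃ c : ℝ, ∀ i, m' i = m i + c) ∧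
        (∀ i j : Fin n, i < j → m (σ₂ j) < m (σ₂ i)) := by
  obtain ⟨m, rfl⟩ : ∃ m, n = m + 3 := ⟨n - 3, by omega⟩
  have hm : 1 ≤ m := by omega
  set N : ℝ := ((m + 3 : ℕ) : ℝ) with hN
  have hNpos : 0 < N := by rw [hN]; positivity
  set K : ℝ := 4 * (N * N) + 4 with hKdef
  have hK : 0 < K := by positivity
  let w : Fin (m + 3) → ℝ := fun i => -((σ₂.symm i : ℕ) : ℝ)
  have hw_nonpos (i) : w i ≤ 0 := neg_nonpos.2 (Nat.cast_nonneg _)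
  have hw_ge (i) : -N ≤ w i := neg_le_neg (Nat.cast_le.2 (σ₂.symm i).is_lt.le)
  let A : Matrix (Fin (m + 3)) (Fin (m + 3)) ℝ := Matrix.of fun i j =>
    K * cyclicTournament m (σ₁.symm i) (σ₁.symm j) + w i - w j
  have hsum (i : Fin (m + 3)) : ∑ j, A (σ₁ i) j
      = K * ∑ k ∈ Finset.range (m + 3), cyclicTournament m i k + N * w (σ₁ i) - ∑ j, w j := by
    simp only [A, Matrix.of_apply, Equiv.symm_apply_apply]
    rw [Finset.sum_sub_distrib, Finset.sum_add_distrib, ← Finset.mul_sum,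
      Equiv.sum_comp σ₁.symm (fun j : Fin (m + 3) => cyclicTournament m i j),
      Fin.sum_univ_eq_sum_range (fun j => cyclicTournament m i j)]
    simp [hN]
  refine ⟨A, ?_, ?_, K, w, ?_, ?_, ?_⟩
  · ext i j
    simp only [A, Matrix.transpose_apply, Matrix.neg_apply, Matrix.of_apply]
    rw [cyclicTournament_neg m (σ₁.symm i) (σ₁.symm j)]
    ring
  · intro i j hij
    unfold hodgeVec
    rw [hsum, hsum]
    refine div_lt_div_of_pos_right ?_ hNpos
    have hgap := mul_le_mul_of_nonneg_left (sum_cyclicTournament_gap hm hij j.is_lt) hK.le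
    have h1 := mul_le_mul_of_nonneg_left (hw_ge (σ₁ i)) hNpos.le
    have h2 := mul_nonpos_of_nonneg_of_nonpos hNpos.le (hw_nonpos (σ₁ j))
    linarith
  · refine fun i => ⟨fun j => ?_, ?_⟩
    · have := mul_le_mul_of_nonneg_left
        (cyclicTournament_le_one m (σ₁.symm i) (σ₁.symm j)) hK.le
      simp only [A, Matrix.of_apply]
      linarith
    · obtain ⟨j, hj⟩ : ∃ j : Fin (m + 3), cyclicTournament m (σ₁.symm i) j = 1 := by
        rcases (show (σ₁.symm i : ℕ) = 0 ∨ (σ₁.symm i : ℕ) = m + 2 ∨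
          (0 < (σ₁.symm i : ℕ) ∧ (σ₁.symm i : ℕ) < m + 2) by omega) with h | h | ⟨h0, h1⟩
        · exact ⟨⟨1, by omega⟩, by rw [h]; exact cyclicTournament_zero_one m⟩
        · exact ⟨⟨0, by omega⟩, by rw [h]; exact cyclicTournament_last_zero m⟩
        · exact ⟨⟨m + 2, by omega⟩, cyclicTournament_last h0 h1⟩
      refine ⟨σ₁ j, ?_⟩
      simp only [A, Matrix.of_apply, Equiv.symm_apply_apply, hj]
      ring
  · intro lam' m' h
    have hv : IsMaxPlusEigenpair
        (Matrix.of fun i j : Fin (m + 3) => K * cyclicTournament m i j) lam'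
        (fun i => m' (σ₁ i) - w (σ₁ i)) := by
      intro i
      obtain ⟨hle, j, hj⟩ := h (σ₁ i)
      simp only [A, Matrix.of_apply, Equiv.symm_apply_apply] at hle hj ⊢
      refine ⟨fun k => ?_, σ₁.symm j, ?_⟩
      · have := hle (σ₁ k)
        rw [Equiv.symm_apply_apply] at this
        linarith
      · rw [Equiv.apply_symm_apply]
        linarith
    obtain ⟨c, hc⟩ := hv.eq_const_of_cyclicTournament hK
    refine ⟨c, fun i => ?_⟩
    have := hc (σ₁.symm i)
    rw [Equiv.apply_symm_apply] at this
    linarith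
  · intro i j hij
    simp only [w, Equiv.symm_apply_apply]
    exact neg_lt_neg (Nat.cast_lt.2 hij)
end

section
/- For every n ≥ 4 and every pair of permutations σ₁, σ₂ of {1,…,n}, there exists a real n×n matrix X with all entries positive and X_{ij}·X_{ji} = 1 for all i, j, such that the row geometric mean vector g, with g_i = (∏_{j=1}^n X_{ij})^{1/n}, satisfies g_{σ₁(1)} > g_{σ₁(2)} > … > g_{σ₁(n)}, and the positive (Perron) eigenvector v of X satisfies v_{σ₂(1)} > v_{σ₂(2)} > … > v_{σ₂(n)}. -/
open Matrix

/-- A row of a positive matrix with a unit entry and sum `n / c - c + 1` has product less than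
`c⁻¹ ^ (n + 1)`. -/
lemma prod_mul_pow_lt_one {n : ℕ} (y : Fin n → ℝ) (i : Fin n) (c : ℝ) (hc : 0 < c) (hc1 : c < 1)
    (hy : ∀ j, 0 < y j) (hi : y i = 1) (hsum : c * (∑ j, y j - 1) = n - c ^ 2) :
    (∏ j, y j) * c ^ (n + 1) < 1 := by
  have hfactor : (∏ j, y j) * c ^ n = c * ∏ j ∈ Finset.univ.erase i, (c * y j) := by
    have h := Finset.mul_prod_erase Finset.univ (fun j => c * y j) (Finset.mem_univ i)
    simp only [hi, mul_one] at h
    rw [h, Finset.prod_mul_distrib]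
    simp [mul_comm]
  have hbound : ∏ j ∈ Finset.univ.erase i, (c * y j) ≤ Real.exp (1 - c ^ 2) := by
    have hexp : ∑ j ∈ Finset.univ.erase i, (c * y j - 1) = 1 - c ^ 2 := by
      have h := Finset.add_sum_erase Finset.univ (fun j => c * y j - 1) (Finset.mem_univ i)
      simp only [hi, mul_one] at h
      rw [Finset.sum_sub_distrib (s := Finset.univ), ← Finset.mul_sum] at h
      simp only [Finset.sum_const, Finset.card_univ, Fintype.card_fin, nsmul_eq_mul, mul_one] at h
      linarith
    rw [← hexp, Real.exp_sum]
    refine Finset.prod_le_prod (fun j _ => (mul_pos hc (hy j)).le) fun j _ => ?_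
    linarith [Real.add_one_le_exp (c * y j - 1)]
  have hlt : c ^ 2 < Real.exp (c ^ 2 - 1) := by
    have h := Real.add_one_lt_exp (x := c ^ 2 - 1) (by nlinarith)
    linarith
  calc (∏ j, y j) * c ^ (n + 1) = c ^ 2 * ∏ j ∈ Finset.univ.erase i, (c * y j) := by
        rw [pow_succ, ← mul_assoc, hfactor]; ring
    _ ≤ c ^ 2 * Real.exp (1 - c ^ 2) := by gcongr
    _ < Real.exp (c ^ 2 - 1) * Real.exp (1 - c ^ 2) := by gcongr
    _ = 1 := by rw [← Real.exp_add]; simp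

/-- For `n ≥ 4` there is a multiplicative paired comparison matrix with constant row sums and
pairwise distinct row products. -/
lemma exists_const_row_sum_injective_row_prod (n : ℕ) (hn : 4 ≤ n) :
    ∃ (Y : Matrix (Fin n) (Fin n) ℝ) (ρ : ℝ),
      (∀ i j, 0 < Y i j) ∧ (∀ i j, Y i j * Y j i = 1) ∧ (n : ℝ) < ρ ∧
      (∀ i, ∑ j, Y i j = ρ) ∧ Function.Injective fun i => ∏ j, Y i j := by
  induction n, hn using Nat.le_induction with
  | base =>
    refine ⟨!![1, 2/3, 3, 1/3; 3/2, 1, 3/4, 7/4; 1/3, 4/3, 1, 7/3; 3, 4/7, 3/7, 1], 5,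
      ?_, ?_, by norm_num, ?_, ?_⟩
    · intro i j
      fin_cases i <;> fin_cases j <;> norm_num
    · intro i j
      fin_cases i <;> fin_cases j <;> norm_num
    · intro i
      fin_cases i <;> simp [Fin.sum_univ_succ] <;> norm_num
    · intro i j
      fin_cases i <;> fin_cases j <;> simp [Fin.prod_univ_succ] <;> norm_num
  | succ n hn ih =>
    obtain ⟨Y, ρ, hpos, hrec, hρ, hsum, hinj⟩ := ih
    have hn0 : (0 : ℝ) < n := by exact_mod_cast (by omega : 0 < n)
    obtain ⟨c, hc, hc1, hroot⟩ : ∃ c : ℝ, 0 < c ∧ c < 1 ∧ c ^ 2 + (ρ - 1) * c - n = 0 := by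
      have h := intermediate_value_Ioo (zero_le_one (α := ℝ))
        (f := fun c : ℝ => c ^ 2 + (ρ - 1) * c - n) (by fun_prop)
      obtain ⟨c, hc, h0⟩ := h (show (0 : ℝ) ∈ _ by constructor <;> simp <;> linarith)
      exact ⟨c, hc.1, hc.2, h0⟩
    have hdiag : ∀ i, Y i i = 1 := fun i => by nlinarith [hrec i i, hpos i i]
    have hnew : ∀ i, c * ∏ j, Y i j < c⁻¹ ^ n := fun i => by
      have h := prod_mul_pow_lt_one (Y i) i c hc hc1 (hpos i) (hdiag i)
        (by rw [hsum]; linarith)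
      rw [inv_pow, ← one_div, lt_div_iff₀ (by positivity)]
      calc c * (∏ j, Y i j) * c ^ n = (∏ j, Y i j) * c ^ (n + 1) := by ring
        _ < 1 := h
    refine ⟨Fin.cons (Fin.cons 1 fun _ => c⁻¹) fun i => Fin.cons c (Y i), ρ + c, ?_, ?_, ?_, ?_, ?_⟩
    · intro i j
      refine Fin.cases ?_ (fun i => ?_) i <;> refine Fin.cases ?_ (fun j => ?_) j <;>
        simp [hc, hpos]
    · intro i j
      refine Fin.cases ?_ (fun i => ?_) i <;> refine Fin.cases ?_ (fun j => ?_) j <;>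
        simp [hc.ne', hrec]
    · push_cast
      nlinarith
    · intro i
      refine Fin.cases ?_ (fun i => ?_) i
      · simp [Fin.sum_univ_succ]
        field_simp
        linarith
      · simp [Fin.sum_univ_succ, hsum, add_comm]
    · intro i j
      refine Fin.cases ?_ (fun i => ?_) i <;> refine Fin.cases ?_ (fun j => ?_) j
      · simp
      · intro h
        simp only [Fin.prod_univ_succ, Fin.cons_zero, Fin.cons_succ, Finset.prod_const,
          Finset.card_univ, Fintype.card_fin, one_mul] at h
        exact absurd h (hnew j).ne'
      · intro h
        simp only [Fin.prod_univ_succ, Fin.cons_zero, Fin.cons_succ, Finset.prod_const,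
          Finset.card_univ, Fintype.card_fin, one_mul] at h
        exact absurd h (hnew i).ne
      · intro h
        simp only [Fin.prod_univ_succ, Fin.cons_zero, Fin.cons_succ] at h
        rw [hinj (mul_left_cancel₀ hc.ne' h)]

/-- for every n ≥ 4 and every pair of rankings σ₁, σ₂ there is an
MPCM X (positive entries, X_{ij}·X_{ji} = 1) whose row geometric mean vector
g_i = (∏_j X_{ij})^{1/n} induces the ranking σ₁ and whose positive (Perron)
eigenvector induces the ranking σ₂. -/
theorem hodge_perron_arbitrary_rankings (n : ℕ) (hn : 4 ≤ n)
    (σ₁ σ₂ : Equiv.Perm (Fin n)) :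
    ∃ X : Matrix (Fin n) (Fin n) ℝ,
      (∀ i j, 0 < X i j) ∧ (∀ i j, X i j * X j i = 1) ∧
      (∀ i j : Fin n, i < j →
        (∏ k, X (σ₁ j) k) ^ ((1 : ℝ) / n) < (∏ k, X (σ₁ i) k) ^ ((1 : ℝ) / n)) ∧
      ∃ ρ : ℝ, ∃ v : Fin n → ℝ, X.mulVec v = ρ • v ∧ (∀ i, 0 < v i) ∧
        (∀ i j : Fin n, i < j → v (σ₂ j) < v (σ₂ i)) := by
  obtain ⟨Y, ρ, hpos, hrec, -, hsum, hinj⟩ := exists_const_row_sum_injective_row_prod n hn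
  obtain ⟨τ, hτ⟩ : ∃ τ : Equiv.Perm (Fin n),
      ∀ i j, i < j → ∏ k, Y (τ j) k < ∏ k, Y (τ i) k := by
    refine ⟨Tuple.sort fun i => -∏ k, Y i k, fun i j hij => ?_⟩
    have hmono := (Tuple.monotone_sort fun i => -∏ k, Y i k).strictMono_of_injective
      ((neg_injective.comp hinj).comp (Equiv.injective _))
    exact neg_lt_neg_iff.mp (hmono hij)
  set π : Equiv.Perm (Fin n) := σ₁.symm.trans τ with hπ
  let v : ℝ → Fin n → ℝ := fun ε i => Real.exp (-(ε * (σ₂.symm i : ℕ)))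
  have hv : ∀ ε i, 0 < v ε i := fun ε i => Real.exp_pos _
  let X : ℝ → Matrix (Fin n) (Fin n) ℝ := fun ε i j => v ε i / v ε j * Y (π i) (π j)
  have hX : ∀ ε i j, 0 < X ε i j := fun ε i j => mul_pos (div_pos (hv ε i) (hv ε j)) (hpos _ _)
  have hprod0 : ∀ i, ∏ k, X 0 (σ₁ i) k = ∏ k, Y (τ i) k := fun i => by
    have h := Equiv.prod_comp π fun k => Y (τ i) k
    simpa [X, v, hπ] using h
  have hev : ∀ᶠ ε in nhds (0 : ℝ), ∀ i j : Fin n, i < j →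
      ∏ k, X ε (σ₁ j) k < ∏ k, X ε (σ₁ i) k := by
    simp only [Filter.eventually_all]
    intro i j hij
    have hcont : ∀ i, Continuous fun ε => ∏ k, X ε i k := fun i =>
      continuous_finsetProd _ fun k _ =>
        (Continuous.div (by fun_prop) (by fun_prop) fun ε => (hv ε k).ne').mul continuous_const
    refine (hcont _).continuousAt.eventually_lt (hcont _).continuousAt ?_
    rw [hprod0, hprod0]
    exact hτ i j hij
  obtain ⟨ε, hε, hε0⟩ :=
    ((hev.filter_mono nhdsWithin_le_nhds).and (self_mem_nhdsWithin (s := Set.Ioi (0 : ℝ)))).exists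
  refine ⟨X ε, hX ε, fun i j => ?_, fun i j hij => ?_, ρ, v ε, ?_, hv ε, fun i j hij => ?_⟩
  · have hi := (hv ε i).ne'
    have hj := (hv ε j).ne'
    calc X ε i j * X ε j i
        = (v ε i / v ε j * (v ε j / v ε i)) * (Y (π i) (π j) * Y (π j) (π i)) := by
          simp only [X]; ring
      _ = 1 := by rw [hrec]; field_simp
  · have hn0 : (0 : ℝ) < n := by exact_mod_cast (by omega : 0 < n)
    exact Real.rpow_lt_rpow (Finset.prod_nonneg fun k _ => (hX ε _ k).le) (hε i j hij)
      (by positivity)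
  · ext i
    change ∑ k, X ε i k * v ε k = ρ • v ε i
    have h := Equiv.sum_comp π fun k => Y (π i) k
    rw [smul_eq_mul, ← hsum (π i), ← h, Finset.sum_mul]
    refine Finset.sum_congr rfl fun k _ => ?_
    have hk := (hv ε k).ne'
    simp only [X]
    field_simp
  · have hij' : ((i : ℕ) : ℝ) < (j : ℕ) := by exact_mod_cast hij
    simp only [v, Equiv.symm_apply_apply]
    exact Real.exp_lt_exp.mpr (neg_lt_neg (mul_lt_mul_of_pos_left hij' hε0))
end

section
/- For every n ≥ 4 and every pair of permutations σ₁, σ₂ of {1,…,n}, there exists a real n×n matrix X with all entries positive and X_{ij}·X_{ji} = 1 for all i, j, such that X has a max-times eigenvector v, unique up to positive scaling, satisfying v_{σ₁(1)} > v_{σ₁(2)} > … > v_{σ₁(n)}, and the positive (Perron) eigenvector u of X satisfies u_{σ₂(1)} > u_{σ₂(2)} > … > u_{σ₂(n)}. -/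
open Matrix

/-- Simultaneous data for a reciprocal matrix `Z`: all its row sums equal `ρ`, and `t` is a
max-times eigenvector for `L` whose maximum in row `i` is attained exactly at `s i`, where every
nonempty `s`-invariant set contains `r`. The number `q` is the constant with which `Z` can be
bordered to a larger matrix of the same kind. -/
structure IsBalanced {n : ℕ} (Z : Fin n → Fin n → ℝ) (ρ L q : ℝ) (t : Fin n → ℝ)
    (s : Fin n → Fin n) (r m : Fin n) : Prop where
  pos : ∀ i j, 0 < Z i j
  recip : ∀ i j, Z i j * Z j i = 1
  row_sum : ∀ i, ∑ j, Z i j = ρ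
  L_pos : 0 < L
  t_pos : ∀ i, 0 < t i
  t_le : ∀ i, t i ≤ 1
  t_inj : Function.Injective t
  t_max : t m = 1
  le : ∀ i j, Z i j * t j ≤ L * t i
  eq_iff : ∀ i j, Z i j * t j = L * t i ↔ j = s i
  mem_of_invariant : ∀ S : Set (Fin n), S.Nonempty → (∀ i ∈ S, s i ∈ S) → r ∈ S
  q_pos : 0 < q
  q_lt : q < 1
  q_eq : q * (q + ρ - 1) = n
  lt_t : ∀ i, 1 < q * L * t i

/-- An eigenvector whose row maxima are attained along a map with a unique cycle is the only
max-times eigenvector up to scaling. -/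
theorem IsMaxTimesEigenpair.eq_smul {n : ℕ} {X : Matrix (Fin n) (Fin n) ℝ} {lam lam' : ℝ}
    {v v' : Fin n → ℝ} {s : Fin n → Fin n} {r : Fin n}
    (hX : ∀ i j, 0 < X i j) (hlam : 0 < lam) (hv : ∀ i, 0 < v i)
    (hle : ∀ i j, X i j * v j ≤ lam * v i)
    (heq : ∀ i j, X i j * v j = lam * v i ↔ j = s i)
    (hr : ∀ S : Set (Fin n), S.Nonempty → (∀ i ∈ S, s i ∈ S) → r ∈ S)
    (h' : IsMaxTimesEigenpair X lam' v') : ∃ c : ℝ, 0 < c ∧ ∀ i, v' i = c * v i := by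
  obtain ⟨hlam', hv', hrow⟩ := h'
  obtain ⟨x, hx⟩ : ∃ x : Fin n → ℝ, ∀ i, v' i = x i * v i :=
    ⟨fun i => v' i / v i, fun i => (div_mul_cancel₀ _ (hv i).ne').symm⟩
  have hxpos : ∀ i, 0 < x i := fun i => by
    have := hv' i
    rw [hx i] at this
    exact pos_of_mul_pos_left this (hv i).le
  have hs : ∀ i, lam * x (s i) ≤ lam' * x i := fun i => by
    have h1 := (hrow i).1 (s i)
    have h2 := (heq i (s i)).2 rfl
    rw [hx, hx] at h1
    refine le_of_mul_le_mul_right ?_ (hv i)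
    calc lam * x (s i) * v i = x (s i) * (lam * v i) := by ring
      _ = X i (s i) * (x (s i) * v (s i)) := by rw [← h2]; ring
      _ ≤ _ := by rw [mul_assoc]; exact h1
  have hj : ∀ i, ∃ j, X i j * v j * x j = lam' * x i * v i := fun i => by
    obtain ⟨j, hj⟩ := (hrow i).2
    refine ⟨j, ?_⟩
    rw [hx, hx] at hj
    linarith
  have : Nonempty (Fin n) := ⟨r⟩
  obtain ⟨a, ha⟩ := Finite.exists_min x
  obtain ⟨b, hb⟩ := Finite.exists_max x
  have h1 : lam ≤ lam' := by
    refine le_of_mul_le_mul_right ?_ (hxpos a)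
    exact (mul_le_mul_of_nonneg_left (ha (s a)) hlam.le).trans (hs a)
  have h2 : lam' ≤ lam := by
    obtain ⟨j, hj⟩ := hj b
    refine le_of_mul_le_mul_right ?_ (mul_pos (hxpos b) (hv b))
    have h3 := mul_le_mul (hle b j) (hb j) (hxpos j).le (mul_pos hlam (hv b)).le
    linarith
  obtain rfl : lam = lam' := le_antisymm h1 h2
  have hs' : ∀ i, x (s i) ≤ x i := fun i => le_of_mul_le_mul_left (hs i) hlam
  have hrmin : ∀ i, x r ≤ x i :=
    hr {i | ∀ k, x i ≤ x k} ⟨a, ha⟩ fun i hi k => (hs' i).trans (hi k)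
  have hrmax : ∀ i, x i ≤ x r := by
    refine hr {i | ∀ k, x k ≤ x i} ⟨b, hb⟩ fun i hi => ?_
    obtain ⟨j, hj⟩ := hj i
    have h3 : lam * v i ≤ X i j * v j := by
      refine le_of_mul_le_mul_right ?_ (hxpos i)
      have := mul_le_mul_of_nonneg_left (hi j) (mul_pos (hX i j) (hv j)).le
      linarith
    have h4 := le_antisymm (hle i j) h3
    have h5 : x j = x i := by
      refine mul_left_cancel₀ (mul_pos hlam (hv i)).ne' ?_
      rw [h4] at hj
      linarith
    obtain rfl := (heq i j).1 h4
    intro k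
    rw [h5]
    exact hi k
  exact ⟨x r, hxpos r, fun i => by rw [hx i, le_antisymm (hrmax i) (hrmin i)]⟩

/-- A balanced matrix of order four. -/
theorem exists_isBalanced_four :
    ∃ (Z : Fin 4 → Fin 4 → ℝ) (ρ L q : ℝ) (t : Fin 4 → ℝ) (s : Fin 4 → Fin 4) (r m : Fin 4),
      IsBalanced Z ρ L q t s r m := by
  obtain ⟨q, ⟨hq1, hq2⟩, hq⟩ : ∃ q ∈ Set.Ioo (1 / 2 : ℝ) 1, q * (q + 16 / 3 - 1) = 4 :=
    intermediate_value_Ioo (f := fun q : ℝ => q * (q + 16 / 3 - 1)) (by norm_num) (by fun_prop) (by norm_num)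
  refine ⟨![![1, 78 / 23, 20 / 69, 15 / 23], ![23 / 78, 1, 30 / 13, 45 / 26],
    ![69 / 20, 13 / 30, 1, 9 / 20], ![23 / 15, 26 / 45, 20 / 9, 1]], 16 / 3, 3, q,
    ![20 / 23, 10 / 13, 1, 20 / 27], ![1, 2, 0, 2], 0, 2, ?_⟩
  constructor
  case mem_of_invariant =>
    rintro S ⟨i, hi⟩ hS
    have h2 : (2 : Fin 4) ∈ S → (0 : Fin 4) ∈ S := hS 2
    have h1 : (1 : Fin 4) ∈ S → (2 : Fin 4) ∈ S := hS 1
    have h3 : (3 : Fin 4) ∈ S → (2 : Fin 4) ∈ S := hS 3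
    fin_cases i
    · exact hi
    · exact h2 (h1 hi)
    · exact h2 hi
    · exact h2 (h3 hi)
  case t_inj =>
    intro i j h
    fin_cases i <;> fin_cases j <;> first | rfl | (norm_num at h)
  case q_eq => simpa using hq
  case q_pos => linarith
  case q_lt => exact hq2
  case lt_t => intro i; fin_cases i <;> simp <;> linarith
  case row_sum => intro i; fin_cases i <;> simp [Fin.sum_univ_four] <;> norm_num
  case eq_iff => intro i j; fin_cases i <;> fin_cases j <;> norm_num <;> decide
  case t_max => rfl
  case L_pos => norm_num
  case t_pos => intro i; fin_cases i <;> norm_num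
  case t_le => intro i; fin_cases i <;> norm_num
  all_goals intro i j; fin_cases i <;> fin_cases j <;> norm_num

/-- Bordering a balanced matrix by the constant `q` gives a balanced matrix. -/
theorem IsBalanced.exists_succ {n : ℕ} {Z : Fin n → Fin n → ℝ} {ρ L q : ℝ} {t : Fin n → ℝ}
    {s : Fin n → Fin n} {r m : Fin n} (h : IsBalanced Z ρ L q t s r m) :
    ∃ (Z : Fin (n + 1) → Fin (n + 1) → ℝ) (ρ L q : ℝ) (t : Fin (n + 1) → ℝ)
      (s : Fin (n + 1) → Fin (n + 1)) (r m : Fin (n + 1)), IsBalanced Z ρ L q t s r m := by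
  have hq0 := h.q_pos
  have hq1 := h.q_lt
  have hL0 := h.L_pos
  have hn : (0 : ℝ) < n := by exact_mod_cast r.pos
  have hqL : 1 < q * L := by simpa [h.t_max] using h.lt_t m
  have hL1 : 1 < L := by nlinarith
  have hqe : q + ρ = 1 + n * q⁻¹ := by
    have := h.q_eq
    field_simp
    linarith
  have hqi : 1 < q⁻¹ := (one_lt_inv₀ hq0).2 hq1
  have ht0 : ∀ i, (q * L)⁻¹ < t i := fun i => by
    rw [inv_lt_iff_one_lt_mul₀ (by positivity)]
    linarith [h.lt_t i]
  obtain ⟨q', ⟨hqq', hq'1⟩, hq'⟩ :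
      ∃ x ∈ Set.Ioo q 1, x * (x + (ρ + q) - 1) = ((n + 1 : ℕ) : ℝ) := by
    refine intermediate_value_Ioo (f := fun x : ℝ => x * (x + (ρ + q) - 1)) hq1.le (by fun_prop) ⟨?_, ?_⟩
    · push_cast
      have := h.q_eq
      nlinarith
    · push_cast
      nlinarith
  refine ⟨Fin.cons (Fin.cons 1 fun _ => q⁻¹) fun i => Fin.cons q (Z i), ρ + q, L, q',
    Fin.cons (q * L)⁻¹ t, Fin.cons m.succ fun i => (s i).succ, r.succ, m.succ, ?_⟩
  have hrow : ∀ i, q * (q * L)⁻¹ < L * t i := fun i => by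
    have h1 : q * (q * L)⁻¹ = L⁻¹ := by field_simp
    have h2 : L⁻¹ < 1 := inv_lt_one_of_one_lt₀ hL1
    have h3 := h.lt_t i
    have h4 := mul_pos hL0 (h.t_pos i)
    rw [h1]
    nlinarith
  have hLt : L * (q * L)⁻¹ = q⁻¹ := by field_simp
  have hdiag : (q * L)⁻¹ < L * (q * L)⁻¹ := by
    have : 0 < (q * L)⁻¹ := by positivity
    nlinarith
  constructor
  case pos =>
    refine Fin.cases (Fin.cases ?_ ?_) fun i => Fin.cases ?_ ?_
    · simp
    · simpa using fun _ => hq0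
    · simpa using hq0
    · simpa using h.pos i
  case recip =>
    refine Fin.cases (Fin.cases ?_ ?_) fun i => Fin.cases ?_ ?_
    · simp
    · simp [hq0.ne']
    · simp [hq0.ne']
    · simpa using h.recip i
  case row_sum =>
    refine Fin.cases ?_ fun i => ?_
    · simp [Fin.sum_univ_succ]
      linarith
    · simp [Fin.sum_univ_succ, h.row_sum, add_comm]
  case L_pos => exact hL0
  case t_pos =>
    refine Fin.cases ?_ fun i => ?_
    · simp only [Fin.cons_zero]; positivity
    · simpa using h.t_pos i
  case t_le =>
    refine Fin.cases ?_ fun i => ?_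
    · simpa only [Fin.cons_zero] using inv_le_one_of_one_le₀ hqL.le
    · simpa using h.t_le i
  case t_inj =>
    refine Fin.cons_injective_iff.2 ⟨?_, h.t_inj⟩
    rintro ⟨i, hi⟩
    exact (ht0 i).ne' hi
  case t_max => simpa using h.t_max
  case le =>
    refine Fin.cases (Fin.cases ?_ fun j => ?_) fun i => Fin.cases ?_ fun j => ?_
    · simpa only [Fin.cons_zero, one_mul] using hdiag.le
    · simp only [Fin.cons_zero, Fin.cons_succ]
      rw [hLt]
      exact mul_le_of_le_one_right (by positivity) (h.t_le j)
    · simpa only [Fin.cons_zero, Fin.cons_succ] using (hrow i).le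
    · simpa using h.le i j
  case eq_iff =>
    refine Fin.cases (Fin.cases ?_ fun j => ?_) fun i => Fin.cases ?_ fun j => ?_
    · simpa only [Fin.cons_zero, one_mul, hdiag.ne, false_iff] using (Fin.succ_ne_zero m).symm
    · simp only [Fin.cons_zero, Fin.cons_succ, hLt, Fin.succ_inj]
      rw [mul_eq_left₀ (by positivity), ← h.t_max, h.t_inj.eq_iff]
    · simpa only [Fin.cons_zero, Fin.cons_succ, (hrow i).ne, false_iff] using
        (Fin.succ_ne_zero (s i)).symm
    · simpa using h.eq_iff i j
  case mem_of_invariant =>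
    rintro S ⟨i, hi⟩ hS
    refine h.mem_of_invariant (Fin.succ ⁻¹' S) ?_ fun j hj => by simpa using hS _ hj
    induction i using Fin.cases with
    | zero => exact ⟨m, by simpa using hS _ hi⟩
    | succ i => exact ⟨i, hi⟩
  case q_pos => linarith
  case q_lt => exact hq'1
  case q_eq => exact hq'
  case lt_t =>
    refine Fin.cases ?_ fun i => ?_
    · simp only [Fin.cons_zero]
      rw [← div_eq_mul_inv, one_lt_div (by positivity)]
      gcongr
    · simp only [Fin.cons_succ]
      have := mul_pos hL0 (h.t_pos i)
      nlinarith [h.lt_t i]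

theorem exists_isBalanced {n : ℕ} (hn : 4 ≤ n) :
    ∃ (Z : Fin n → Fin n → ℝ) (ρ L q : ℝ) (t : Fin n → ℝ) (s : Fin n → Fin n) (r m : Fin n),
      IsBalanced Z ρ L q t s r m := by
  induction n, hn using Nat.le_induction with
  | base => exact exists_isBalanced_four
  | succ n _ ih =>
    obtain ⟨Z, ρ, L, q, t, s, r, m, h⟩ := ih
    exact h.exists_succ

/-- A vector inducing a prescribed ranking can be chosen so close to constant that multiplying by
it preserves the order of the entries of `t`. -/
theorem exists_ranking_preserving {n : ℕ} (t : Fin n → ℝ) (σ : Equiv.Perm (Fin n)) :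
    ∃ d : Fin n → ℝ, (∀ i, 0 < d i) ∧ (∀ i j, i < j → d (σ j) < d (σ i)) ∧
      ∀ i j, t i < t j → d i * t i < d j * t j := by
  have key : ∀ᶠ ε : ℝ in nhdsWithin 0 (Set.Ioi 0), ∀ i j, t i < t j →
      Real.exp (-ε * (σ.symm i : ℕ)) * t i < Real.exp (-ε * (σ.symm j : ℕ)) * t j := by
    refine Filter.Eventually.filter_mono nhdsWithin_le_nhds ?_
    simp only [Filter.eventually_all]
    intro i j hij
    have hc : ∀ k, Continuous fun ε : ℝ => Real.exp (-ε * (σ.symm k : ℕ)) * t k :=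
      fun k => by fun_prop
    exact (hc i).continuousAt.eventually_lt (hc j).continuousAt (by simpa using hij)
  obtain ⟨ε, hε, hε0⟩ := (key.and self_mem_nhdsWithin).exists
  refine ⟨fun i => Real.exp (-ε * (σ.symm i : ℕ)), fun i => Real.exp_pos _, ?_, hε⟩
  intro i j hij
  have h1 : ((i : ℕ) : ℝ) < (j : ℕ) := by exact_mod_cast hij
  simp only [Equiv.symm_apply_apply, Real.exp_lt_exp, neg_mul, neg_lt_neg_iff]
  exact mul_lt_mul_of_pos_left h1 hε0


/-- for every n ≥ 4 and every pair of rankings σ₁, σ₂ there is an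
MPCM X (positive entries, X_{ij}·X_{ji} = 1) which has a max-times eigenvector,
unique up to positive scaling, inducing the ranking σ₁, and whose positive
(Perron) eigenvector induces the ranking σ₂. -/
theorem tropical_perron_arbitrary_rankings (n : ℕ) (hn : 4 ≤ n)
    (σ₁ σ₂ : Equiv.Perm (Fin n)) :
    ∃ X : Matrix (Fin n) (Fin n) ℝ,
      (∀ i j, 0 < X i j) ∧ (∀ i j, X i j * X j i = 1) ∧
      (∃ lam : ℝ, ∃ v : Fin n → ℝ, IsMaxTimesEigenpair X lam v ∧
        (∀ lam' : ℝ, ∀ v' : Fin n → ℝ, IsMaxTimesEigenpair X lam' v' →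
          ∃ c : ℝ, 0 < c ∧ ∀ i, v' i = c * v i) ∧
        (∀ i j : Fin n, i < j → v (σ₁ j) < v (σ₁ i))) ∧
      ∃ ρ : ℝ, ∃ u : Fin n → ℝ, X.mulVec u = ρ • u ∧ (∀ i, 0 < u i) ∧
        (∀ i j : Fin n, i < j → u (σ₂ j) < u (σ₂ i)) := by
  obtain ⟨Z, ρ, L, q, t, s, r, m, h⟩ := exists_isBalanced hn
  obtain ⟨π, hπ⟩ : ∃ π : Equiv.Perm (Fin n), ∀ i j, i < j → t (π (σ₁ j)) < t (π (σ₁ i)) := by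
    refine ⟨(σ₁.symm.trans Fin.revPerm).trans (Tuple.sort t), fun i j hij => ?_⟩
    have hmono : StrictMono (t ∘ Tuple.sort t) :=
      (Tuple.monotone_sort t).strictMono_of_injective (h.t_inj.comp (Tuple.sort t).injective)
    simpa using hmono (Fin.rev_lt_rev.2 hij)
  obtain ⟨d, hd, hdσ, hdt⟩ := exists_ranking_preserving (t ∘ π) σ₂
  have hd0 : ∀ i, d i ≠ 0 := fun i => (hd i).ne'
  have hXv : ∀ i j, d i / d j * Z (π i) (π j) * (d j * t (π j)) =
      d i * (Z (π i) (π j) * t (π j)) := fun i j => by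
    have := hd0 j
    field_simp
  have hLv : ∀ i, L * (d i * t (π i)) = d i * (L * t (π i)) := fun i => by ring
  have hle : ∀ i j, d i / d j * Z (π i) (π j) * (d j * t (π j)) ≤ L * (d i * t (π i)) :=
    fun i j => by
      rw [hXv, hLv]
      exact mul_le_mul_of_nonneg_left (h.le _ _) (hd i).le
  have heq : ∀ i j, d i / d j * Z (π i) (π j) * (d j * t (π j)) = L * (d i * t (π i)) ↔
      j = π.symm (s (π i)) := fun i j => by
    rw [hXv, hLv, mul_right_inj' (hd0 i), h.eq_iff, Equiv.eq_symm_apply]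
  have hX : ∀ i j, 0 < d i / d j * Z (π i) (π j) := fun i j =>
    mul_pos (div_pos (hd i) (hd j)) (h.pos _ _)
  have hv : ∀ i, 0 < d i * t (π i) := fun i => mul_pos (hd i) (h.t_pos _)
  refine ⟨Matrix.of fun i j => d i / d j * Z (π i) (π j), hX, fun i j => ?_,
    ⟨L, fun i => d i * t (π i),
      ⟨h.L_pos, hv, fun i => ⟨hle i, _, (heq i _).2 rfl⟩⟩,
      fun lam' v' h' => ?_, fun i j hij => hdt _ _ (hπ i j hij)⟩, ρ, d, ?_, hd, hdσ⟩
  · have h1 := h.recip (π i) (π j)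
    have := hd0 i
    have := hd0 j
    simp only [Matrix.of_apply]
    field_simp
    exact h1
  · refine IsMaxTimesEigenpair.eq_smul (r := π.symm r) hX h.L_pos hv hle heq
      (fun S hS hinv => ?_) h'
    refine h.mem_of_invariant (π.symm ⁻¹' S) ?_ fun i hi => by simpa using hinv _ hi
    obtain ⟨i, hi⟩ := hS
    exact ⟨π i, by simpa using hi⟩
  · ext i
    have h1 : ∀ j, d i / d j * Z (π i) (π j) * d j = d i * Z (π i) (π j) := fun j => by
      have := hd0 j
      field_simp
    simp only [Matrix.mulVec, dotProduct, Matrix.of_apply, h1, Pi.smul_apply, smul_eq_mul]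
    rw [← Finset.mul_sum, Equiv.sum_comp π (Z (π i)), h.row_sum, mul_comm]
end

section
/- Let X be a real n×n matrix with all entries positive, and suppose X has a max-times eigenvector v_max, unique up to positive scaling, normalized so that (v_max)_1 = 1. For each k ≥ 1 let v⁽ᵏ⁾ denote the positive (Perron) eigenvector of the Hadamard power X⁽ᵏ⁾ (the matrix with entries X_{ij}ᵏ), normalized so that v⁽ᵏ⁾_1 = 1. Then for every i, (v⁽ᵏ⁾_i)^{1/k} → (v_max)_i as k → ∞. -/
open Matrix Filter

/-- Taking `k`-th roots in a Perron eigenvector equation for `X⁽ᵏ⁾` gives a max-times eigenvector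
equation for `X` up to a factor `n ^ (1 / k)`. -/
lemma root_eigenvector_bounds {n : ℕ} {X : Matrix (Fin n) (Fin n) ℝ} (hX : ∀ i j, 0 < X i j)
    {k : ℕ} (hk : 1 ≤ k) {u : Fin n → ℝ} {μ : ℝ} (hu : ∀ i, 0 < u i)
    (h : (Matrix.of fun i j => X i j ^ k).mulVec u = μ • u) (i : Fin n) :
    (∀ j, X i j * u j ^ ((1 : ℝ) / k) ≤ μ ^ ((1 : ℝ) / k) * u i ^ ((1 : ℝ) / k)) ∧
      ∃ j, μ ^ ((1 : ℝ) / k) * u i ^ ((1 : ℝ) / k) ≤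
        (n : ℝ) ^ ((1 : ℝ) / k) * (X i j * u j ^ ((1 : ℝ) / k)) := by
  have hk0 : k ≠ 0 := by omega
  have hn : 0 < n := i.pos
  have hroot : ∀ x : ℝ, 0 ≤ x → (x ^ ((1 : ℝ) / k)) ^ k = x := fun x hx => by
    rw [one_div]
    exact Real.rpow_inv_natCast_pow hx hk0
  have hsum : ∑ j, X i j ^ k * u j = μ * u i := by
    simpa [Matrix.mulVec, dotProduct] using congrFun h i
  have hterm : ∀ j, 0 < X i j ^ k * u j := fun j => mul_pos (pow_pos (hX i j) k) (hu j)
  have hμ : 0 ≤ μ := by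
    have : 0 ≤ μ * u i := hsum ▸ Finset.sum_nonneg fun j _ => (hterm j).le
    exact nonneg_of_mul_nonneg_left this (hu i)
  have hr : ∀ x : ℝ, 0 ≤ x → 0 ≤ x ^ ((1 : ℝ) / k) := fun x hx => Real.rpow_nonneg hx _
  refine ⟨fun j => ?_, ?_⟩
  · refine le_of_pow_le_pow_left₀ hk0 (mul_nonneg (hr _ hμ) (hr _ (hu i).le)) ?_
    rw [mul_pow, mul_pow, hroot _ (hu j).le, hroot _ hμ, hroot _ (hu i).le, ← hsum]
    exact Finset.single_le_sum (f := fun j => X i j ^ k * u j) (fun j _ => (hterm j).le)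
      (Finset.mem_univ j)
  · obtain ⟨j, -, hj⟩ : ∃ j ∈ Finset.univ, μ * u i / n ≤ X i j ^ k * u j := by
      refine Finset.exists_le_of_sum_le ⟨i, Finset.mem_univ i⟩ ?_
      rw [hsum, Finset.sum_const, Finset.card_univ, Fintype.card_fin, nsmul_eq_mul]
      exact (mul_div_cancel₀ _ (by positivity)).le
    refine ⟨j, le_of_pow_le_pow_left₀ hk0 (mul_nonneg (hr _ n.cast_nonneg)
      (mul_nonneg (hX i j).le (hr _ (hu j).le))) ?_⟩
    rw [mul_pow, mul_pow, mul_pow, hroot _ (hu j).le, hroot _ hμ, hroot _ (hu i).le,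
      hroot _ n.cast_nonneg]
    rwa [div_le_iff₀' (by positivity)] at hj

/-- A limit of approximate max-times eigenpairs, with multiplicative error tending to `1`, is a
max-times eigenpair as soon as it is positive. -/
lemma isMaxTimesEigenpair_of_tendsto {n : ℕ} {X : Matrix (Fin n) (Fin n) ℝ}
    {w : ℕ → Fin n → ℝ} {r c : ℕ → ℝ} {a : Fin n → ℝ} {s : ℝ}
    (hw : Tendsto w atTop (nhds a)) (hr : Tendsto r atTop (nhds s))
    (hc : Tendsto c atTop (nhds 1)) (hs : 0 < s) (ha : ∀ i, 0 < a i)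
    (hle : ∀ᶠ k in atTop, ∀ i j, X i j * w k j ≤ r k * w k i)
    (hge : ∀ᶠ k in atTop, ∀ i, ∃ j, r k * w k i ≤ c k * (X i j * w k j)) :
    IsMaxTimesEigenpair X s a := by
  have hw' : ∀ i, Tendsto (fun k => w k i) atTop (nhds (a i)) := fun i => tendsto_pi_nhds.1 hw i
  have hle' : ∀ i j, X i j * a j ≤ s * a i := fun i j =>
    le_of_tendsto_of_tendsto ((hw' j).const_mul _) (hr.mul (hw' i)) (hle.mono fun k hk => hk i j)
  refine ⟨hs, ha, fun i => ⟨hle' i, ?_⟩⟩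
  by_contra! hne
  have hlt : ∀ᶠ k in atTop, ∀ j, c k * (X i j * w k j) < r k * w k i := by
    refine eventually_all.2 fun j => ?_
    refine (hc.mul ((hw' j).const_mul (X i j))).eventually_lt (hr.mul (hw' i)) ?_
    rw [one_mul]
    exact lt_of_le_of_ne (hle' i j) (hne j)
  obtain ⟨k, hk, hk'⟩ := (hlt.and hge).exists
  obtain ⟨j, hj⟩ := hk' i
  exact absurd (hk j) hj.not_gt

/-- Uniform bounds for normalized approximate max-times eigenpairs. -/
lemma approx_eigenpair_bounds {n : ℕ} {X : Matrix (Fin n) (Fin n) ℝ} (hX : ∀ i j, 0 < X i j)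
    {M : ℝ} (hM : ∀ i j, X i j ≤ M) {w : Fin n → ℝ} {r c C : ℝ} (hw : ∀ i, 0 < w i)
    {o : Fin n} (ho : w o = 1) (hc : 0 ≤ c) (hcC : c ≤ C)
    (hle : ∀ i j, X i j * w j ≤ r * w i) (hge : ∀ i, ∃ j, r * w i ≤ c * (X i j * w j)) :
    r ∈ Set.Icc (X o o) (C * M) ∧ ∀ i, w i ∈ Set.Icc (X i o / (C * M)) (C * M / X o i) := by
  have hr1 : X o o ≤ r := by simpa [ho] using hle o o
  have hr0 : 0 < r := (hX o o).trans_le hr1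
  have hr2 : r ≤ C * M := by
    have : Nonempty (Fin n) := ⟨o⟩
    obtain ⟨i, hi⟩ := Finite.exists_max w
    obtain ⟨j, hj⟩ := hge i
    have hM0 : 0 < M := (hX i j).trans_le (hM i j)
    have h1 : X i j * w j ≤ M * w i := mul_le_mul (hM i j) (hi j) (hw j).le hM0.le
    have h2 : c * (X i j * w j) ≤ C * (M * w i) :=
      mul_le_mul hcC h1 (mul_pos (hX i j) (hw j)).le (hc.trans hcC)
    refine le_of_mul_le_mul_right ?_ (hw i)
    linarith
  refine ⟨⟨hr1, hr2⟩, fun i => ⟨?_, ?_⟩⟩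
  · rw [div_le_iff₀' (hr0.trans_le hr2)]
    calc X i o = X i o * w o := by rw [ho, mul_one]
      _ ≤ r * w i := hle i o
      _ ≤ C * M * w i := mul_le_mul_of_nonneg_right hr2 (hw i).le
  · rw [le_div_iff₀' (hX o i)]
    calc X o i * w i ≤ r * w o := hle o i
      _ ≤ C * M := by rwa [ho, mul_one]


/-- let X be a positive n×n matrix whose max-times eigenvector
v_max is unique up to positive scaling and normalized by (v_max)_1 = 1. If v⁽ᵏ⁾
denotes the Perron eigenvector of the k-th Hadamard power X⁽ᵏ⁾, normalized so that
v⁽ᵏ⁾_1 = 1, then (v⁽ᵏ⁾_i)^{1/k} → (v_max)_i as k → ∞, for every i. -/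
theorem perron_of_hadamard_powers_tendsto_tropical (n : ℕ) (hn : 0 < n)
    (X : Matrix (Fin n) (Fin n) ℝ) (hpos : ∀ i j, 0 < X i j)
    (lam : ℝ) (vmax : Fin n → ℝ) (hv : IsMaxTimesEigenpair X lam vmax)
    (huniq : ∀ lam' : ℝ, ∀ v' : Fin n → ℝ, IsMaxTimesEigenpair X lam' v' →
      ∃ c : ℝ, 0 < c ∧ ∀ i, v' i = c * vmax i)
    (hnorm : vmax ⟨0, hn⟩ = 1)
    (v : ℕ → Fin n → ℝ) (ρ : ℕ → ℝ)
    (hev : ∀ k, 1 ≤ k →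
      (Matrix.of fun i j => X i j ^ k).mulVec (v k) = ρ k • v k)
    (hvpos : ∀ k, 1 ≤ k → ∀ i, 0 < v k i)
    (hvnorm : ∀ k, 1 ≤ k → v k ⟨0, hn⟩ = 1) :
    ∀ i, Tendsto (fun k : ℕ => v k i ^ ((1 : ℝ) / k)) atTop (nhds (vmax i)) := by
  have hn1 : (1 : ℝ) ≤ n := by exact_mod_cast hn
  set o : Fin n := ⟨0, hn⟩
  set w : ℕ → Fin n → ℝ := fun k i => v k i ^ ((1 : ℝ) / k) with hw
  set r : ℕ → ℝ := fun k => ρ k ^ ((1 : ℝ) / k)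
  set c : ℕ → ℝ := fun k => (n : ℝ) ^ ((1 : ℝ) / k)
  have hclim : Tendsto c atTop (nhds 1) := by
    exact (Real.continuous_const_rpow (by positivity)).tendsto' 0 1 (Real.rpow_zero _) |>.comp
      (tendsto_one_div_atTop_nhds_zero_nat (𝕜 := ℝ))
  have hb : ∀ k, 1 ≤ k → ∀ i, (∀ j, X i j * w k j ≤ r k * w k i) ∧
      ∃ j, r k * w k i ≤ c k * (X i j * w k j) := fun k hk i =>
    root_eigenvector_bounds hpos hk (hvpos k hk) (hev k hk) i
  obtain ⟨M, hM⟩ : ∃ M, ∀ i j, X i j ≤ M := by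
    obtain ⟨M, hM⟩ := (Set.finite_range fun p : Fin n × Fin n => X p.1 p.2).bddAbove
    exact ⟨M, fun i j => hM ⟨(i, j), rfl⟩⟩
  have hM0 : 0 < M := (hpos o o).trans_le (hM o o)
  have hwo : ∀ k, 1 ≤ k → w k o = 1 := fun k hk => by simp [hw, hvnorm k hk]
  have hK : ∀ k, 1 ≤ k → r k ∈ Set.Icc (X o o) (n * M) ∧
      ∀ i, w k i ∈ Set.Icc (X i o / (n * M)) (n * M / X o i) := fun k hk => by
    refine approx_eigenpair_bounds hpos hM (c := c k)
      (fun i => Real.rpow_pos_of_pos (hvpos k hk i) _) (hwo k hk)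
      (Real.rpow_nonneg n.cast_nonneg _) ?_ (fun i => (hb k hk i).1) (fun i => (hb k hk i).2)
    refine Real.rpow_le_self_of_one_le hn1 ?_
    rw [div_le_one (by exact_mod_cast hk)]
    exact_mod_cast hk
  suffices h : Tendsto w atTop (nhds vmax) from fun i => tendsto_pi_nhds.1 h i
  refine tendsto_of_subseq_tendsto fun ns hns => ?_
  have hns1 : ∀ᶠ m in atTop, 1 ≤ ns m := hns.eventually_ge_atTop 1
  have hcomp : IsCompact (Set.Icc (X o o) (n * M) ×ˢ
      Set.univ.pi fun i => Set.Icc (X i o / (n * M)) (n * M / X o i)) :=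
    isCompact_Icc.prod (isCompact_univ_pi fun i => isCompact_Icc)
  obtain ⟨⟨s, a⟩, ⟨hs, ha⟩, ms, hms, hlim⟩ := hcomp.tendsto_subseq'
    (x := fun m => (r (ns m), w (ns m)))
    (hns1.mono fun m hm => ⟨(hK _ hm).1, fun i _ => (hK _ hm).2 i⟩).frequently
  have hrlim : Tendsto (fun m => r (ns (ms m))) atTop (nhds s) := hlim.fst_nhds
  have hwlim : Tendsto (fun m => w (ns (ms m))) atTop (nhds a) := hlim.snd_nhds
  have hev1 : ∀ᶠ m in atTop, 1 ≤ ns (ms m) := hms.tendsto_atTop.eventually hns1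
  have hpair : IsMaxTimesEigenpair X s a :=
    isMaxTimesEigenpair_of_tendsto hwlim hrlim
      (hclim.comp (hns.comp hms.tendsto_atTop)) ((hpos o o).trans_le hs.1)
      (fun i => (div_pos (hpos i o) (by positivity)).trans_le (ha i (Set.mem_univ i)).1)
      (hev1.mono fun m hm i => (hb _ hm i).1) (hev1.mono fun m hm i => (hb _ hm i).2)
  have hao : a o = 1 := tendsto_nhds_unique_of_eventuallyEq (tendsto_pi_nhds.1 hwlim o)
    tendsto_const_nhds (hev1.mono fun m hm => hwo _ hm)
  obtain ⟨d, -, hd⟩ := huniq s a hpair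
  have hd1 : d = 1 := by simpa [hao, hnorm] using (hd o).symm
  have hav : a = vmax := funext fun i => by rw [hd i, hd1, one_mul]
  exact ⟨ms, hav ▸ hwlim⟩
end
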